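/- arXiv:1401.5665 — 5 statements merged into one kernel-verified Lean document; each statement's English description precedes it below -/
import Mathlib

section
/- The interval I_str(L) of strong partial clones on 𝟚 whose total part is the clone L of linear Boolean functions has the cardinality of the continuum (2^{ℵ₀}). -/
namespace StrongPartial

/-- Partial functions of arity `n+1` on `A` (arities are `≥ 1`).
`f.2 x = some a` means `x ∈ dom f` with value `a`; `f.2 x = none` means `x ∉ dom f`. -/
def PF (A : Type) : Type := Σ n : ℕ, (Fin (n+1) → A) → Option A

variable {A : Type}

/-- `f` is a total function. -/
def IsTotalPF (f : PF A) : Prop := ∀ x, (f.2 x).isSome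

/-- The set of all total functions on `A`. -/
def OSet (A : Type) : Set (PF A) := {f | IsTotalPF f}

/-- The `(n+1)`-ary projection onto the `i`-th coordinate. -/
def proj (n : ℕ) (i : Fin (n+1)) : PF A := ⟨n, fun x => some (x i)⟩

/-- Composition of an arity-`k` partial function with `k` partial functions of arity `m`. -/
def compFun {k m : ℕ} (f : (Fin k → A) → Option A) (g : Fin k → ((Fin m → A) → Option A)) :
    (Fin m → A) → Option A :=
  fun x => if h : ∀ i, (g i x).isSome then f (fun i => (g i x).get (h i)) else none

/-- A partial clone: contains all projections and is closed under composition. -/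
def IsPartialClone (X : Set (PF A)) : Prop :=
  (∀ (n : ℕ) (i : Fin (n+1)), proj n i ∈ X) ∧
  (∀ f ∈ X, ∀ (m : ℕ) (g : Fin (f.1+1) → ((Fin (m+1) → A) → Option A)),
     (∀ i, (⟨m, g i⟩ : PF A) ∈ X) → (⟨m, compFun f.2 g⟩ : PF A) ∈ X)

/-- A total clone: a partial clone consisting of total functions. -/
def IsClone (C : Set (PF A)) : Prop := IsPartialClone C ∧ C ⊆ OSet A

/-- `f ≤ g`: `f` is a restriction (subfunction) of `g`. -/
def PFle (f g : PF A) : Prop :=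
  ∃ h : f.1 = g.1, ∀ (x : Fin (f.1+1) → A) (a : A),
    f.2 x = some a → g.2 (fun i => x (Fin.cast (by rw [h]) i)) = some a

/-- `Str X`: all restrictions of members of `X`. -/
def StrSet (X : Set (PF A)) : Set (PF A) := {f | ∃ g ∈ X, PFle f g}

/-- `X` is strong (restriction closed). -/
def IsStrong (X : Set (PF A)) : Prop := StrSet X = X

/-- `f` preserves the `h`-ary relation `ρ`. -/
def Preserves (f : PF A) {h : ℕ} (ρ : Set (Fin h → A)) : Prop :=
  ∀ (M : Fin h → Fin (f.1+1) → A) (v : Fin h → A),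
    (∀ j, (fun i => M i j) ∈ ρ) → (∀ i, f.2 (M i) = some (v i)) → v ∈ ρ

def pPolSet {h : ℕ} (ρ : Set (Fin h → A)) : Set (PF A) := {f | Preserves f ρ}

def PolSet {h : ℕ} (ρ : Set (Fin h → A)) : Set (PF A) := pPolSet ρ ∩ OSet A

/-- `f` preserves the relation pair `(ρ, ρ')`. -/
def PreservesPair (f : PF A) {h : ℕ} (ρ ρ' : Set (Fin h → A)) : Prop :=
  ∀ (M : Fin h → Fin (f.1+1) → A) (v : Fin h → A),
    (∀ j, (fun i => M i j) ∈ ρ) → (∀ i, f.2 (M i) = some (v i)) → v ∈ ρ'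

def cPolSet {h : ℕ} (ρ ρ' : Set (Fin h → A)) : Set (PF A) := {f | PreservesPair f ρ ρ'}

/-- The interval `I_str(C)` of strong partial clones with total part `C`. -/
def Istr (C : Set (PF A)) : Set (Set (PF A)) :=
  {X | IsPartialClone X ∧ IsStrong X ∧ X ∩ OSet A = C}

/-! Maltsev operations -/

def zeta (f : PF A) : PF A := ⟨f.1, fun x => f.2 (fun i => x (i + 1))⟩

def tau (f : PF A) : PF A := ⟨f.1, fun x => f.2 (fun i => x (Equiv.swap 0 1 i))⟩

def nabla (f : PF A) : PF A := ⟨f.1 + 1, fun x => f.2 (fun i => x i.succ)⟩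

def delta (f : PF A) : PF A :=
  match f with
  | ⟨0, g⟩ => ⟨0, g⟩
  | ⟨n+1, g⟩ => ⟨n, fun x => g (fun i => x ⟨i.val - 1, by have := i.isLt; omega⟩)⟩

/-- `f ⋆ g`. -/
def starPF (f g : PF A) : PF A :=
  ⟨f.1 + g.1, fun x =>
    (g.2 (fun j => x ⟨j.val, by have := j.isLt; omega⟩)).bind
      (fun a => f.2 (fun i =>
        if i.val = 0 then a else x ⟨g.1 + i.val, by have := i.isLt; omega⟩))⟩

/-- A partial class: closed under `ζ`, `τ`, `Δ`, `∇` and `⋆`. -/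
def IsPartialClass (X : Set (PF A)) : Prop :=
  (∀ f ∈ X, zeta f ∈ X) ∧ (∀ f ∈ X, tau f ∈ X) ∧ (∀ f ∈ X, delta f ∈ X) ∧
  (∀ f ∈ X, nabla f ∈ X) ∧ (∀ f ∈ X, ∀ g ∈ X, starPF f g ∈ X)

def starSet (X Y : Set (PF A)) : Set (PF A) := {h | ∃ f ∈ X, ∃ g ∈ Y, h = starPF f g}

/-- The constant function of arity `n+1` with value `a`. -/
def constPF (a : A) (n : ℕ) : PF A := ⟨n, fun _ => some a⟩

/-- The total clone generated by a set `G` of total functions. -/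
def cloneGen (G : Set (PF A)) : Set (PF A) := ⋂₀ {C | IsClone C ∧ G ⊆ C}


/-! Boolean-specific definitions (`0 = false`, `1 = true`). -/

/-- `T_0 = Pol {(0)}`. -/
def relT0 : Set (Fin 1 → Bool) := {fun _ => false}

/-- `T_1 = Pol {(1)}`. -/
def relT1 : Set (Fin 1 → Bool) := {fun _ => true}

/-- `{(0,0),(0,1),(1,1)}`, defining the monotone functions. -/
def relM : Set (Fin 2 → Bool) := {![false, false], ![false, true], ![true, true]}

/-- `{(0,1),(1,0)}`, defining the self-dual functions. -/
def relS : Set (Fin 2 → Bool) := {![false, true], ![true, false]}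

/-- `{(x,x,y,y),(x,y,x,y),(x,y,y,x) : x,y ∈ 𝟚}`, defining the linear functions. -/
def relL : Set (Fin 4 → Bool) :=
  {v | ∃ x y : Bool, v = ![x, x, y, y] ∨ v = ![x, y, x, y] ∨ v = ![x, y, y, x]}

def T0 : Set (PF Bool) := PolSet relT0
def T1 : Set (PF Bool) := PolSet relT1
def Mclone : Set (PF Bool) := PolSet relM
def Sclone : Set (PF Bool) := PolSet relS
def Lclone : Set (PF Bool) := PolSet relL

/-- `ρ_{0,2} = {(0,0),(0,1),(1,0)}`. -/
def rel02 : Set (Fin 2 → Bool) := {![false, false], ![false, true], ![true, false]}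

/-- `T_{0,2} = Pol ρ_{0,2}`. -/
def T02 : Set (PF Bool) := PolSet rel02

/-- Cyclic successor on `Fin n`. -/
def cyc {n : ℕ} (i : Fin n) : Fin n := ⟨(i.val + 1) % n, Nat.mod_lt _ (by have := i.isLt; omega)⟩

/-- `R^{0,2}_{C,n}`: the cyclic-graph relation. -/
def RC (n : ℕ) : Set (Fin n → Bool) := {x | ∀ i : Fin n, ![x i, x (cyc i)] ∈ rel02}

/-- `R^{0,2}_{K,n}`: the complete-graph relation. -/
def RK (n : ℕ) : Set (Fin n → Bool) := {x | ∀ i j : Fin n, i ≠ j → ![x i, x j] ∈ rel02}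

/-- `R^{0,2}_n := R^{0,2}_{C,n} × R^{0,2}_{K,n} ⊆ 𝟚^{2n}`. -/
def R02 (n : ℕ) : Set (Fin (n + n) → Bool) :=
  {x | (fun i => x (Fin.castAdd n i)) ∈ RC n ∧ (fun i => x (Fin.natAdd n i)) ∈ RK n}

/-- The binary conjunction as a partial (total) function. -/
def andPF : PF Bool := ⟨1, fun x => some (x 0 && x 1)⟩

/-- The constant Boolean functions `c_0, c_1` of all arities. -/
def constantsBool : Set (PF Bool) :=
  {f | ∃ n : ℕ, f = constPF false n ∨ f = constPF true n}

/-- `C_{01}`: the clone generated by the constants `c_0, c_1`. -/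
def C01 : Set (PF Bool) := cloneGen constantsBool

/-- `Λ`: the clone generated by `∧, c_0, c_1`. -/
def LambdaClone : Set (PF Bool) := cloneGen (insert andPF constantsBool)

/-- The monster relation `R^Λ_m ⊆ 𝟚^{m+1}` (coordinates 0-indexed: index 0 is the paper's 1). -/
def RLam (m : ℕ) : Set (Fin (m+1) → Bool) :=
  {x | (x 0 = true ∨ ∃ j : Fin (m+1), j ≠ 0 ∧ x j = false) ∧
       ∀ i j1 j2 : Fin (m+1), i ≠ 0 → j1 ≠ 0 → j2 ≠ 0 → i ≠ j1 → i ≠ j2 → j1 ≠ j2 →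
         (x i = true ∨ x 0 = false ∨ x j1 = false ∨ x j2 = false)}

/-- `n(k,p) := (2k−1)p + 1`. -/
def nkp (k p : ℕ) : ℕ := (2 * k - 1) * p + 1

/-- The `n(k,p)`-ary partial function `τ_p^k`. -/
def tauPF (k p : ℕ) : PF Bool :=
  ⟨nkp k p - 1, fun x =>
    if ∀ i, x i = true then some true
    else if (Finset.univ.filter (fun i => x i = true)).card ≤ p then some false
    else none⟩

/-- `p_1 := 1`, `p_j := n(j, p_{j−1})` for `j ≥ 2`. -/
def pseq : ℕ → ℕ
  | 0 => 1
  | 1 => 1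
  | (j+2) => nkp (j+2) (pseq (j+1))

/-- `ξ_j := τ^{j+1}_{p_j}`. -/
def xi (j : ℕ) : PF Bool := tauPF (j + 1) (pseq j)

/-- `ρ_C = {(0,0,0,0),(0,0,1,1),(0,1,0,1),(1,1,1,1)}`. -/
def rhoC : Set (Fin 4 → Bool) :=
  {![false, false, false, false], ![false, false, true, true],
   ![false, true, false, true], ![true, true, true, true]}

/-- `ρ_1 = ρ_C ∪ {(1,0,1,0),(1,1,0,0)}`. -/
def rho1 : Set (Fin 4 → Bool) :=
  rhoC ∪ {![true, false, true, false], ![true, true, false, false]}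

/-- `f_a`: extension of `f` fixing the new first coordinate to `a`. -/
def extConst {A : Type} [DecidableEq A] (a : A) (f : PF A) : PF A :=
  ⟨f.1 + 1, fun x => if x 0 = a then f.2 (fun i => x i.succ) else none⟩



theorem bad1_card {V : Type} [AddCommGroup V] [Fintype V] [DecidableEq V] {N : ℕ}
    (S : Finset (Fin N)) (hS : S.Nonempty) :
    (Finset.univ.filter (fun p : Fin N → V => ∑ i ∈ S, p i = 0)).card * Fintype.card V
      ≤ (Fintype.card V) ^ N := by
  classical
  obtain ⟨i0, hi0⟩ := hS
  have h : ((Finset.univ.filter (fun p : Fin N → V => ∑ i ∈ S, p i = 0)) ×ˢ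
      (Finset.univ : Finset V)).card ≤ (Finset.univ : Finset (Fin N → V)).card := by
    apply Finset.card_le_card_of_injOn (fun q => q.1 + Pi.single i0 q.2)
    · intro q _; simp
    · rintro ⟨p, v⟩ hp ⟨q, w⟩ hq h
      simp only [Finset.coe_product, Set.mem_prod, Finset.mem_coe, Finset.mem_filter,
        Finset.mem_univ, true_and, and_true] at hp hq h
      have key : ∀ (p : Fin N → V) (v : V), ∑ i ∈ S, p i = 0 →
          ∑ i ∈ S, (p + (Pi.single i0 v : Fin N → V)) i = v := by
        intro p v hp
        simp only [Pi.add_apply, Finset.sum_add_distrib, hp, zero_add]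
        simp [Pi.single_apply, hi0]
      have hvw : v = w := by rw [← key p v hp, ← key q w hq, h]
      subst hvw
      have : p = q := add_right_cancel h
      rw [this]
  simpa [Finset.card_product] using h

theorem exists_tuple {V : Type} [AddCommGroup V] [Fintype V] [DecidableEq V] {ι : Type} [Fintype ι]
    (N K : ℕ) (hK : 1 ≤ K) (B : ι → Finset V)
    (hB : ∀ i, 4 * (B i).card ≤ 3 * Fintype.card V)
    (h1 : N ^ K * 2 < Fintype.card V) (h2 : 2 * Fintype.card ι * 3 ^ N ≤ 4 ^ N) :
    ∃ p : Fin N → V, (∀ t : Fin K → Fin N, ∑ i ∈ Finset.univ.image t, p i ≠ 0) ∧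
      ∀ i, ∃ n, p n ∉ B i := by
  classical
  by_contra hcon
  push Not at hcon
  set c := Fintype.card V with hc
  let b1 : (Fin K → Fin N) → Finset (Fin N → V) := fun t =>
    Finset.univ.filter (fun p : Fin N → V => ∑ i ∈ Finset.univ.image t, p i = 0)
  let b2 : ι → Finset (Fin N → V) := fun i => Fintype.piFinset (fun _ => B i)
  have hcov : (Finset.univ : Finset (Fin N → V)) ⊆ Finset.univ.biUnion b1 ∪ Finset.univ.biUnion b2 := by
    intro p _
    simp only [Finset.mem_union, Finset.mem_biUnion, Finset.mem_univ, true_and]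
    by_cases hp : ∀ t : Fin K → Fin N, ∑ i ∈ Finset.univ.image t, p i ≠ 0
    · right
      obtain ⟨i, hi⟩ := hcon p hp
      exact ⟨i, by simpa [b2, Fintype.mem_piFinset] using hi⟩
    · left
      push Not at hp
      obtain ⟨t, ht⟩ := hp
      exact ⟨t, by simpa [b1] using ht⟩
  have hcard := Finset.card_le_card hcov
  have hX : (Finset.univ : Finset (Fin N → V)).card = c ^ N := by simp [hc]
  rw [hX] at hcard
  have e1 : (Finset.univ.biUnion b1).card * c ≤ N ^ K * c ^ N := by
    calc (Finset.univ.biUnion b1).card * c ≤ (∑ t, (b1 t).card) * c :=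
          Nat.mul_le_mul_right _ Finset.card_biUnion_le
      _ = ∑ t, (b1 t).card * c := Finset.sum_mul _ _ _
      _ ≤ ∑ _t : Fin K → Fin N, c ^ N := by
          apply Finset.sum_le_sum
          intro t _
          apply bad1_card
          exact ⟨t ⟨0, hK⟩, Finset.mem_image_of_mem _ (Finset.mem_univ _)⟩
      _ = N ^ K * c ^ N := by simp
  have e2 : (Finset.univ.biUnion b2).card * 4 ^ N ≤ Fintype.card ι * (3 ^ N * c ^ N) := by
    calc (Finset.univ.biUnion b2).card * 4 ^ N ≤ (∑ t, (b2 t).card) * 4 ^ N :=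
          Nat.mul_le_mul_right _ Finset.card_biUnion_le
      _ = ∑ t, (b2 t).card * 4 ^ N := Finset.sum_mul _ _ _
      _ ≤ ∑ _t : ι, 3 ^ N * c ^ N := by
          apply Finset.sum_le_sum
          intro t _
          simp only [b2, Fintype.card_piFinset, Finset.prod_const, Finset.card_univ, Fintype.card_fin]
          rw [← mul_pow, ← mul_pow]
          apply Nat.pow_le_pow_left
          have := hB t
          omega
      _ = _ := by simp
  have e3 := hcard.trans (Finset.card_union_le _ _)
  set x := (Finset.univ.biUnion b1).card
  set y := (Finset.univ.biUnion b2).card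
  have cpos : 0 < c := by omega
  have Xpos : 0 < c ^ N := by positivity
  have fpos : 0 < 4 ^ N := by positivity
  set X := c ^ N
  set F := 4 ^ N
  set T := 3 ^ N
  have g1 : 2 * (x * c) * F < c * X * F := by
    have : 2 * (x * c) ≤ (N ^ K * 2) * X := by nlinarith
    have h3 : (N ^ K * 2) * X < c * X := Nat.mul_lt_mul_of_pos_right h1 Xpos
    exact Nat.mul_lt_mul_of_pos_right (this.trans_lt h3) fpos
  have g2 : 2 * (y * F) * c ≤ F * X * c := by
    have h3 : (2 * Fintype.card ι * T) * X ≤ F * X := Nat.mul_le_mul_right _ h2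
    have : 2 * (y * F) ≤ (2 * Fintype.card ι * T) * X := by nlinarith
    exact Nat.mul_le_mul_right _ (this.trans h3)
  have g3 : X * (2 * c * F) ≤ (x + y) * (2 * c * F) := Nat.mul_le_mul_right _ e3
  nlinarith

theorem bool_self (V : Type) (x : V → Bool) : x + x = 0 := by
  funext i
  simp only [Pi.add_apply, Pi.zero_apply]
  cases x i <;> rfl

theorem density {V : Type} [AddCommGroup V] [Fintype V] [DecidableEq V] (B : Finset V) (u w : V)
    (h : ∀ x, ¬ (x ∈ B ∧ x + u ∈ B ∧ x + w ∈ B ∧ x + (u + w) ∈ B)) :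
    4 * B.card ≤ 3 * Fintype.card V := by
  have sh : ∀ v : V, ∑ x : V, (if x + v ∈ B then (1 : ℕ) else 0) = B.card := by
    intro v
    have := Equiv.sum_comp (Equiv.addRight v) (fun x => if x ∈ B then (1 : ℕ) else 0)
    refine Eq.trans ?_ (this.trans (by simp))
    rfl
  have h0 : ∑ x : V, (if x ∈ B then 1 else 0) = B.card := by simp
  calc 4 * B.card = ∑ x : V, ((if x ∈ B then 1 else 0) + (if x + u ∈ B then 1 else 0) +
        (if x + w ∈ B then 1 else 0) + (if x + (u + w) ∈ B then 1 else 0)) := by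
        rw [Finset.sum_add_distrib, Finset.sum_add_distrib, Finset.sum_add_distrib, sh, sh, sh, h0]
        ring
    _ ≤ ∑ _x : V, 3 := by
        apply Finset.sum_le_sum
        intro x _
        have := h x
        split_ifs <;> simp_all
    _ = 3 * Fintype.card V := by simp [mul_comm]

/-- Sets without nondegenerate parallelograms. -/
def Sidon {r : ℕ} (Q : Set (Fin r → Bool)) : Prop :=
  ∀ x u w, u ≠ 0 → w ≠ 0 → u ≠ w → ¬ (x ∈ Q ∧ x + u ∈ Q ∧ x + w ∈ Q ∧ x + (u + w) ∈ Q)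

theorem numeric (K : ℕ) : ∃ k N : ℕ, k + 1 < N ∧ 1 ≤ k ∧ N ^ K * 2 < 2 ^ k ∧
    2 * (2 ^ (2 ^ K) * (2 ^ k) ^ K) * 3 ^ N ≤ 4 ^ N := by
  set C := 3 * (2 ^ K + K + 2) with hC
  have ht := tendsto_pow_const_div_const_pow_of_one_lt K (r := 2) (by norm_num)
  have hpos : (0 : ℝ) < 1 / (2 * C ^ K) := by
    have : (0 : ℝ) < C := by rw [hC]; positivity
    positivity
  obtain ⟨k, hk, hk1⟩ := ((ht.eventually_lt_const hpos).and (Filter.eventually_ge_atTop 1)).exists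
  have hpow : 0 < 2 ^ K := by positivity
  have hmul := Nat.zero_le (k * K)
  refine ⟨k, 3 * (2 ^ K + k * K + 1 + k), by generalize 2 ^ K = z at *; generalize k * K = y at *; omega, hk1, ?_, ?_⟩
  · have h1 : 3 * (2 ^ K + k * K + 1 + k) ≤ C * k := by
      rw [hC]
      have : 2 ^ K ≤ 2 ^ K * k := Nat.le_mul_of_pos_right _ hk1
      nlinarith
    have h2 : (C * k) ^ K * 2 < 2 ^ k := by
      have hCp : (0 : ℝ) < C := by rw [hC]; positivity
      rw [div_lt_div_iff₀ (by positivity) (by positivity)] at hk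
      have : (((C * k) ^ K * 2 : ℕ) : ℝ) < ((2 ^ k : ℕ) : ℝ) := by
        push_cast
        rw [mul_pow]; linarith
      exact_mod_cast this
    exact (Nat.mul_le_mul_right _ (Nat.pow_le_pow_left h1 K)).trans_lt h2
  · set a := 2 ^ K + k * K + 1 with ha
    have h3 : 2 * (2 ^ (2 ^ K) * (2 ^ k) ^ K) = 2 ^ a := by
      rw [ha, ← pow_mul]; ring
    rw [h3, pow_mul, pow_mul]
    calc 2 ^ a * (3 ^ 3) ^ (a + k) ≤ 2 ^ (a + k) * (3 ^ 3) ^ (a + k) :=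
          Nat.mul_le_mul_right _ (Nat.pow_le_pow_right (by norm_num) (by omega))
      _ = (2 * 3 ^ 3) ^ (a + k) := by rw [mul_pow]
      _ ≤ (4 ^ 3) ^ (a + k) := Nat.pow_le_pow_left (by norm_num) _

theorem exists_config (K : ℕ) (hK : 1 ≤ K) : ∃ (k N : ℕ) (p : Fin N → Fin (k + 1) → Bool),
    k + 2 < N ∧
    (∀ S : Finset (Fin N), S.Nonempty → S.card ≤ K → ∑ i ∈ S, p i ≠ 0) ∧
    (∀ (Q : Set (Fin K → Bool)) (A : Matrix (Fin K) (Fin (k + 1)) Bool), Sidon Q →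
      (∀ i, A.mulVec (p i) ∈ Q) → ∃ c d, ∀ i, A.mulVec (p i) = c ∨ A.mulVec (p i) = d) := by
  classical
  obtain ⟨k', N, hN, hk', h1, h2⟩ := numeric K
  obtain ⟨k, rfl⟩ : ∃ k, k' = k + 1 := ⟨k' - 1, by omega⟩
  let ι := {x : Set (Fin K → Bool) × Matrix (Fin K) (Fin (k + 1)) Bool //
    4 * (Finset.univ.filter (fun v : Fin (k + 1) → Bool => x.2.mulVec v ∈ x.1)).card
      ≤ 3 * Fintype.card (Fin (k + 1) → Bool)}
  have hι : Fintype.card ι ≤ 2 ^ (2 ^ K) * (2 ^ (k + 1)) ^ K := by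
    refine (Fintype.card_subtype_le _).trans ?_
    rw [Fintype.card_prod]
    have : Fintype.card (Matrix (Fin K) (Fin (k + 1)) Bool) = (2 ^ (k + 1)) ^ K := by
      have : Fintype.card (Fin K → Fin (k + 1) → Bool) = (2 ^ (k + 1)) ^ K := by simp
      rw [← this]; exact Fintype.card_congr (Equiv.refl _)
    rw [this]
    simp
  obtain ⟨p, hp1, hp2⟩ := exists_tuple (V := Fin (k + 1) → Bool) (ι := ι) N K hK
    (fun x => Finset.univ.filter (fun v : Fin (k + 1) → Bool => x.1.2.mulVec v ∈ x.1.1))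
    (fun x => x.2) (by simpa using h1)
    (le_trans (Nat.mul_le_mul_right _ (Nat.mul_le_mul_left _ hι)) h2)
  refine ⟨k, N, p, hN, ?_, ?_⟩
  · intro S hS hSK
    obtain ⟨i0, hi0⟩ := hS
    have : ∃ t : Fin K → Fin N, Finset.univ.image t = S := by
      let e := S.equivFin
      refine ⟨fun j => if h : j.val < S.card then (e.symm ⟨j.val, h⟩).1 else i0, ?_⟩
      ext x
      simp only [Finset.mem_image, Finset.mem_univ, true_and]
      constructor
      · rintro ⟨j, rfl⟩
        split_ifs
        · exact (e.symm _).2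
        · exact hi0
      · intro hx
        refine ⟨⟨(e ⟨x, hx⟩).val, (e ⟨x, hx⟩).isLt.trans_le hSK⟩, ?_⟩
        simp
    obtain ⟨t, rfl⟩ := this
    exact hp1 t
  · intro Q A hQ hA
    by_cases hu : ∃ u w, A.mulVec u ≠ 0 ∧ A.mulVec w ≠ 0 ∧ A.mulVec u ≠ A.mulVec w
    · exfalso
      obtain ⟨u, w, hu, hw, huw⟩ := hu
      have hd := density (Finset.univ.filter (fun v : Fin (k + 1) → Bool => A.mulVec v ∈ Q)) u w (by
        intro x
        simp only [Finset.mem_filter, Finset.mem_univ, true_and, Matrix.mulVec_add]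
        exact hQ _ _ _ hu hw huw)
      obtain ⟨n, hn⟩ := hp2 ⟨(Q, A), hd⟩
      exact hn (by simpa using hA n)
    · push Not at hu
      by_cases hz : ∃ u, A.mulVec u ≠ 0
      · obtain ⟨u, hu0⟩ := hz
        refine ⟨0, A.mulVec u, fun i => ?_⟩
        by_cases h0 : A.mulVec (p i) = 0
        · exact Or.inl h0
        · exact Or.inr (hu u (p i) hu0 h0).symm
      · push Not at hz
        exact ⟨0, 0, fun i => Or.inl (hz _)⟩

theorem interpolate {k N K : ℕ} (p : Fin N → Fin k → Bool)
    (h : ∀ S : Finset (Fin N), S.Nonempty → S.card ≤ K → ∑ i ∈ S, p i ≠ 0)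
    (S : Finset (Fin N)) (hS : S.card ≤ K) (φ : Fin N → Bool) :
    ∃ a : Fin k → Bool, ∀ i ∈ S, a ⬝ᵥ p i = φ i := by
  classical
  let _ : Field Bool := IsField.toField (R := Bool)
    ⟨⟨false, true, by decide⟩, mul_comm, fun {a} ha => ⟨a, by cases a; exact absurd rfl ha; rfl⟩⟩
  have hli : LinearIndependent Bool (fun i : S => p i) := by
    rw [Fintype.linearIndependent_iff]
    intro g hg
    by_contra hne
    push Not at hne
    obtain ⟨i0, hi0⟩ := hne
    let T : Finset S := Finset.univ.filter (fun i => g i ≠ 0)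
    refine h (T.map (Function.Embedding.subtype _)) ?_ ?_ ?_
    · exact ⟨i0.1, by simp [T, hi0]⟩
    · rw [Finset.card_map]
      exact (Finset.card_le_univ _).trans (by simpa using hS)
    · rw [Finset.sum_map, ← hg, Finset.sum_filter]
      apply Finset.sum_congr rfl
      intro i _
      by_cases hi : g i = 0
      · simp [hi]
      · have : g i = 1 := by
          cases hgi : g i
          · exact absurd hgi hi
          · rfl
        simp [this]
  let F0 := (Module.Basis.span hli).constr Bool (fun i : S => φ i)
  obtain ⟨F, hF⟩ := LinearMap.exists_extend F0
  refine ⟨fun j => F (Pi.single j 1), fun i hi => ?_⟩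
  have h1 : F (p i) = φ i := by
    have h2 : F (p i) = F0 (Module.Basis.span hli ⟨i, hi⟩) := by
      rw [← hF]
      simp [Module.Basis.span_apply]
    rw [h2, Module.Basis.constr_basis]
  rw [← h1]
  conv_rhs => rw [LinearMap.pi_apply_eq_sum_univ F (p i)]
  simp only [dotProduct, smul_eq_mul]
  apply Finset.sum_congr rfl
  intro j _
  rw [mul_comm]
  congr 2
  funext l
  simp [Pi.single_apply, eq_comm]

theorem pPol_proj {A : Type} {h : ℕ} (ρ : Set (Fin h → A)) (n : ℕ) (i : Fin (n + 1)) :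
    proj n i ∈ pPolSet ρ := by
  intro M v hc hr
  have : v = fun l => M l i := by
    funext l
    have := hr l
    simp only [proj, Option.some.injEq] at this
    exact this.symm
  rw [this]
  exact hc i

theorem pPol_comp {A : Type} {h : ℕ} (ρ : Set (Fin h → A)) (f : PF A) (hf : f ∈ pPolSet ρ)
    (m : ℕ) (g : Fin (f.1 + 1) → ((Fin (m + 1) → A) → Option A))
    (hg : ∀ i, (⟨m, g i⟩ : PF A) ∈ pPolSet ρ) : (⟨m, compFun f.2 g⟩ : PF A) ∈ pPolSet ρ := by
  intro M v hc hr
  have hs : ∀ i, ∀ j, (g j (M i)).isSome := by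
    intro i
    by_contra hne
    have := hr i
    simp only [compFun, dif_neg hne] at this
    exact absurd this (by simp)
  refine hf (fun i j => (g j (M i)).get (hs i j)) v ?_ ?_
  · intro j
    refine hg j M _ hc ?_
    intro i
    simp
  · intro i
    have := hr i
    simp only [compFun, dif_pos (hs i)] at this
    exact this

theorem pPol_restrict {A : Type} {h : ℕ} (ρ : Set (Fin h → A)) (f g : PF A) (hg : g ∈ pPolSet ρ)
    (hfg : PFle f g) : f ∈ pPolSet ρ := by
  obtain ⟨n, f⟩ := f
  obtain ⟨n', g⟩ := g
  obtain ⟨e, hfg⟩ := hfg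
  dsimp only at e
  subst e
  intro M v hc hr
  refine hg M v hc ?_
  intro i
  exact hfg (M i) (v i) (hr i)

theorem PFle_refl {A : Type} (f : PF A) : PFle f f := ⟨rfl, fun _ _ h => h⟩

theorem relL_iff (v : Fin 4 → Bool) : v ∈ relL ↔ v 0 + v 1 + v 2 + v 3 = 0 := by
  constructor
  · rintro ⟨x, y, h | h | h⟩ <;> subst h <;> revert x y <;> decide
  · intro h
    have hv : v = ![v 0, v 1, v 2, v 3] := by
      funext i; fin_cases i <;> rfl
    have key : ∀ a b c d : Bool, a + b + c + d = 0 → ∃ x y : Bool,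
        ![a, b, c, d] = ![x, x, y, y] ∨ ![a, b, c, d] = ![x, y, x, y] ∨
          ![a, b, c, d] = ![x, y, y, x] := by decide
    have := key _ _ _ _ h
    rw [← hv] at this
    exact this

theorem bool_add_self (a : Bool) : a + a = 0 := by cases a <;> rfl

theorem total_affine (f : PF Bool) (hf : f ∈ Lclone) :
    ∃ (a : Fin (f.1 + 1) → Bool) (b : Bool), ∀ x, f.2 x = some (a ⬝ᵥ x + b) := by
  obtain ⟨hp, ht⟩ := hf
  have ht' : ∀ x, ∃ y, f.2 x = some y := fun x => Option.isSome_iff_exists.mp (ht x)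
  choose F hF using ht'
  have hadd : ∀ x y, F (x + y) + F 0 = (F x + F 0) + (F y + F 0) := by
    intro x y
    have h1 := hp ![x, y, x + y, 0] ![F x, F y, F (x + y), F 0] ?_ ?_
    · rw [relL_iff] at h1
      have h2 : F x + F y + F (x + y) + F 0 = 0 := h1
      revert h2
      generalize F x = a; generalize F y = b; generalize F (x + y) = c; generalize F 0 = d
      revert a b c d
      decide
    · intro j
      rw [relL_iff]
      show x j + y j + (x + y) j + (0 : Fin (f.1 + 1) → Bool) j = 0
      simp only [Pi.add_apply, Pi.zero_apply]
      generalize x j = a; generalize y j = b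
      revert a b; decide
    · intro i
      fin_cases i <;> exact hF _
  let G : (Fin (f.1 + 1) → Bool) →+ Bool :=
    { toFun := fun x => F x + F 0
      map_zero' := bool_add_self _
      map_add' := hadd }
  refine ⟨fun j => G (Pi.single j 1), F 0, fun x => ?_⟩
  rw [hF x]
  congr 1
  have h1 : G x = ∑ j, G (Pi.single j 1) * x j := by
    conv_lhs => rw [← Finset.univ_sum_single x]
    rw [map_sum]
    apply Finset.sum_congr rfl
    intro j _
    cases hx : x j
    · have : (Pi.single j false : Fin (f.1 + 1) → Bool) = 0 := Pi.single_zero j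
      rw [this, map_zero]
      exact (mul_zero _).symm
    · exact (mul_one _).symm
  have h2 : G x = F x + F 0 := rfl
  unfold dotProduct
  rw [← h1, h2, add_assoc, bool_add_self, add_zero]

/-- The affine functions restricted to the point configuration `p`. -/
def relP {k N : ℕ} (p : Fin N → Fin k → Bool) : Set (Fin N → Bool) :=
  {v | ∃ (a : Fin k → Bool) (b : Bool), ∀ i, v i = a ⬝ᵥ p i + b}

theorem relP_cols {k N r : ℕ} (p : Fin N → Fin k → Bool) (M : Fin N → Fin r → Bool)
    (h : ∀ j, (fun i => M i j) ∈ relP p) :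
    ∃ (α : Matrix (Fin r) (Fin k) Bool) (β : Fin r → Bool), ∀ i, M i = α.mulVec (p i) + β := by
  choose α β hαβ using h
  exact ⟨α, β, fun i => funext fun j => hαβ j i⟩

theorem relP_affine {k N r : ℕ} (p : Fin N → Fin k → Bool) (M : Fin N → Fin r → Bool)
    (h : ∀ j, (fun i => M i j) ∈ relP p) (a : Fin r → Bool) (b : Bool) :
    (fun i => a ⬝ᵥ M i + b) ∈ relP p := by
  obtain ⟨α, β, hM⟩ := relP_cols p M h
  refine ⟨Matrix.vecMul a α, a ⬝ᵥ β + b, fun i => ?_⟩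
  simp only [hM i, dotProduct_add, Matrix.dotProduct_mulVec, add_assoc]

theorem L_sub_relP {k N : ℕ} (p : Fin N → Fin k → Bool) (f : PF Bool) (hf : f ∈ Lclone) :
    f ∈ pPolSet (relP p) := by
  obtain ⟨a, b, hab⟩ := total_affine f hf
  intro M v hc hr
  have : v = fun i => a ⬝ᵥ M i + b := by
    funext i
    have := hr i
    rw [hab] at this
    exact (Option.some.inj this).symm
  rw [this]
  exact relP_affine p M hc a b

/-- Configurations of points. -/
structure Config (K : ℕ) where
  k : ℕ
  N : ℕ
  p : Fin N → Fin (k + 1) → Bool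
  hN : k + 2 < N
  indep : ∀ S : Finset (Fin N), S.Nonempty → S.card ≤ K → ∑ i ∈ S, p i ≠ 0
  coll : ∀ (Q : Set (Fin K → Bool)) (A : Matrix (Fin K) (Fin (k + 1)) Bool), Sidon Q →
      (∀ i, A.mulVec (p i) ∈ Q) → ∃ c d, ∀ i, A.mulVec (p i) = c ∨ A.mulVec (p i) = d

theorem config_nonempty (K : ℕ) : Nonempty (Config (K + 4)) := by
  obtain ⟨k, N, p, h1, h2, h3⟩ := exists_config (K + 4) (by omega)
  exact ⟨⟨k, N, p, h1, h2, h3⟩⟩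

theorem exists_nonaffine {K : ℕ} (c : Config K) : ∃ φ : Fin c.N → Bool, φ ∉ relP c.p := by
  by_contra h
  push Not at h
  have hs : Function.Surjective (fun (x : (Fin (c.k + 1) → Bool) × Bool) (i : Fin c.N) =>
      x.1 ⬝ᵥ c.p i + x.2) := by
    intro φ
    obtain ⟨a, b, hab⟩ := h φ
    exact ⟨(a, b), funext fun i => (hab i).symm⟩
  have h1 := Fintype.card_le_of_surjective _ hs
  simp only [Fintype.card_prod, Fintype.card_fun, Fintype.card_bool, Fintype.card_fin] at h1
  rw [← pow_succ, Nat.pow_le_pow_iff_right (by norm_num)] at h1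
  have := c.hN
  omega

noncomputable def Config.phi {K : ℕ} (c : Config K) : Fin c.N → Bool := (exists_nonaffine c).choose

open Classical in
noncomputable def Config.F {K : ℕ} (c : Config K) : PF Bool :=
  ⟨c.k, fun x => if h : ∃ i, c.p i = x then some (c.phi h.choose) else none⟩

theorem F_some {K : ℕ} (c : Config K) (x : Fin (c.k + 1) → Bool) (y : Bool)
    (h : c.F.2 x = some y) : ∃ i, x = c.p i ∧ y = c.phi i := by
  by_cases hx : ∃ i, c.p i = x
  · simp only [Config.F, dif_pos hx, Option.some.injEq] at h
    exact ⟨hx.choose, hx.choose_spec.symm, h.symm⟩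
  · simp only [Config.F, dif_neg hx] at h
    exact absurd h (by simp)

theorem p_inj {K : ℕ} (hK : 4 ≤ K) (c : Config K) : Function.Injective c.p := by
  intro i j hij
  by_contra hne
  refine c.indep {i, j} ⟨i, by simp⟩ ((Finset.card_le_two).trans (by omega)) ?_
  rw [Finset.sum_pair hne, hij]
  exact bool_self _ _

theorem F_apply {K : ℕ} (hK : 4 ≤ K) (c : Config K) (i : Fin c.N) :
    c.F.2 (c.p i) = some (c.phi i) := by
  have hx : ∃ j, c.p j = c.p i := ⟨i, rfl⟩
  have : hx.choose = i := p_inj hK c hx.choose_spec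
  simp only [Config.F, dif_pos hx, this]

theorem F_not_mem {K : ℕ} (hK : 4 ≤ K) (c : Config K) : c.F ∉ pPolSet (relP c.p) := by
  intro h
  refine (exists_nonaffine c).choose_spec (h c.p c.phi ?_ (F_apply hK c))
  intro j
  refine ⟨Pi.single (M := fun _ : Fin (c.k + 1) => Bool) j 1, 0, fun i => ?_⟩
  rw [add_zero]
  exact (single_one_dotProduct (n := Fin (c.k + 1)) j (c.p i)).symm

theorem F_key {K : ℕ} (c : Config K) {k N : ℕ} (q : Fin N → Fin k → Bool)
    (M : Fin N → Fin (c.k + 1) → Bool) (v : Fin N → Bool)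
    (hc : ∀ j, (fun i => M i j) ∈ relP q) (s : Fin N → Fin c.N) (hs : ∀ i, M i = c.p (s i))
    (hv : ∀ i, v i = c.phi (s i)) (hcard : (Finset.univ.image s).card ≤ K) : v ∈ relP q := by
  obtain ⟨a, ha⟩ := interpolate c.p c.indep _ hcard c.phi
  have : v = fun i => a ⬝ᵥ M i + 0 := by
    funext i
    rw [hv, hs, ha _ (Finset.mem_image_of_mem _ (Finset.mem_univ _)), add_zero]
  rw [this]
  exact relP_affine q M hc a 0

theorem F_relL {K : ℕ} (hK : 4 ≤ K) (c : Config K) : c.F ∈ pPolSet relL := by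
  intro M0 v hc0 hr
  let M : Fin 4 → Fin (c.k + 1) → Bool := M0
  have hc : ∀ j : Fin (c.k + 1), (fun i => M i j) ∈ relL := hc0
  replace hr : ∀ i, c.F.2 (M i) = some (v i) := hr
  clear_value M
  clear hc0
  have := fun i  => F_some c (M i) (v i) (hr i)
  choose s hs hv using this
  obtain ⟨a, ha⟩ := interpolate c.p c.indep (Finset.univ.image s)
    ((Finset.card_image_le).trans (by simpa using hK)) c.phi
  have hv' : ∀ i, v i = a ⬝ᵥ M i := by
    intro i
    rw [hv, hs, ha _ (Finset.mem_image_of_mem _ (Finset.mem_univ _))]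
  rw [relL_iff, hv', hv', hv', hv', ← dotProduct_add, ← dotProduct_add, ← dotProduct_add]
  have h0 : M 0 + M 1 + M 2 + M 3 = 0 := by
    funext j
    exact (relL_iff _).1 (hc j)
  rw [h0, dotProduct_zero]

theorem F_small {K K' : ℕ} (c : Config K) (c' : Config K') (h : c'.N ≤ K) :
    c.F ∈ pPolSet (relP c'.p) := by
  intro M0 v hc0 hr
  let M : Fin _ → Fin (c.k + 1) → Bool := M0
  have hc : ∀ j : Fin (c.k + 1), (fun i => M i j) ∈ relP c'.p := hc0
  replace hr : ∀ i, c.F.2 (M i) = some (v i) := hr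
  clear_value M
  clear hc0
  have := fun i  => F_some c (M i) (v i) (hr i)
  choose s hs hv using this
  exact F_key c c'.p M v hc s hs hv ((Finset.card_image_le).trans (by simpa using h))

theorem sidon_range {K : ℕ} (hK : 4 ≤ K) (c : Config K) : Sidon (Set.range c.p) := by
  rintro x u w hu hw huw ⟨⟨i, hi⟩, ⟨j, hj⟩, ⟨l, hl⟩, ⟨q, hq⟩⟩
  have hneg : ∀ a b : Fin (c.k + 1) → Bool, a + b = 0 → a = b := by
    intro a b hab
    have := congrArg (· + b) hab
    simpa [add_assoc, bool_self] using this
  have hij : i ≠ j := by rintro rfl; rw [hi] at hj; exact hu (by simpa using hj)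
  have hil : i ≠ l := by rintro rfl; rw [hi] at hl; exact hw (by simpa using hl)
  have hiq : i ≠ q := by
    rintro rfl; rw [hi] at hq; exact huw (hneg _ _ (by simpa using hq))
  have hjl : j ≠ l := by rintro rfl; rw [hj] at hl; exact huw (by simpa using hl)
  have hjq : j ≠ q := by rintro rfl; rw [hj] at hq; exact hw (by simpa using hq)
  have hlq : l ≠ q := by rintro rfl; rw [hl] at hq; exact hu (by simpa using hq)
  refine c.indep {i, j, l, q} ⟨i, by simp⟩ ((Finset.card_le_four).trans hK) ?_
  rw [Finset.sum_insert (by simp [hij, hil, hiq]), Finset.sum_insert (by simp [hjl, hjq]),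
    Finset.sum_pair hlq, hi, hj, hl, hq]
  funext t
  have key : ∀ a b d : Bool, a + (a + b + (a + d + (a + (b + d)))) = 0 := by decide
  exact key (x t) (u t) (w t)

theorem F_large {K K' : ℕ} (hK : 4 ≤ K) (c : Config K) (c' : Config K') (h : c.k + 1 ≤ K') :
    c.F ∈ pPolSet (relP c'.p) := by
  classical
  intro M0 v hc0 hr
  let M : Fin _ → Fin (c.k + 1) → Bool := M0
  have hc : ∀ j : Fin (c.k + 1), (fun i => M i j) ∈ relP c'.p := hc0
  replace hr : ∀ i, c.F.2 (M i) = some (v i) := hr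
  clear_value M
  clear hc0
  have := fun i  => F_some c (M i) (v i) (hr i)
  choose s hs hv using this
  refine F_key c c'.p M v hc s hs hv ?_
  obtain ⟨α, β, hM⟩ := relP_cols c'.p M hc
  have hM : ∀ i, M i = α.mulVec (c'.p i) + β := hM
  let g : Fin K' → Fin (c.k + 1) := fun x => ⟨min x.val c.k, by omega⟩
  let σ : Fin (c.k + 1) → Fin K' := Fin.castLE h
  have hgσ : ∀ x, g (σ x) = x := by
    intro x
    apply Fin.ext
    simp only [g, σ, Fin.val_castLE]
    omega
  let Q : Set (Fin K' → Bool) := {y | y ∘ σ + β ∈ Set.range c.p ∧ (y ∘ σ) ∘ g = y}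
  have hQ : Sidon Q := by
    rintro x u w hu hw huw ⟨⟨x1, x2⟩, ⟨u1, u2⟩, ⟨w1, w2⟩, ⟨z1, -⟩⟩
    have hfix : ∀ y, ((x + y) ∘ σ) ∘ g = x + y → (y ∘ σ) ∘ g = y := by
      intro y hy
      funext t
      have h1 := congrFun hy t
      have h2 := congrFun x2 t
      simp only [Function.comp_apply, Pi.add_apply] at h1 h2 ⊢
      rw [h2] at h1
      exact add_left_cancel h1
    have hu2 := hfix u u2
    have hw2 := hfix w w2
    refine sidon_range hK c (x ∘ σ + β) (u ∘ σ) (w ∘ σ) ?_ ?_ ?_ ⟨x1, ?_, ?_, ?_⟩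
    · intro h0; apply hu; rw [← hu2, h0]; rfl
    · intro h0; apply hw; rw [← hw2, h0]; rfl
    · intro h0; apply huw; rw [← hu2, h0, hw2]
    · convert u1 using 1; funext t; simp only [Function.comp_apply, Pi.add_apply]; ring
    · convert w1 using 1; funext t; simp only [Function.comp_apply, Pi.add_apply]; ring
    · convert z1 using 1; funext t; simp only [Function.comp_apply, Pi.add_apply]; ring
  have hA : ∀ i, (α.submatrix g id).mulVec (c'.p i) = (α.mulVec (c'.p i)) ∘ g := fun i => rfl
  have hback : ∀ y : Fin (c.k + 1) → Bool, (y ∘ g) ∘ σ = y := by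
    intro y; funext t; simp only [Function.comp_apply, hgσ]
  obtain ⟨a, b, hab⟩ := c'.coll Q (α.submatrix g id) hQ (by
    intro i
    rw [hA]
    refine ⟨⟨s i, ?_⟩, ?_⟩
    · rw [hback, ← hM, hs]
    · rw [hback])
  have hsub : (Finset.univ.image s).image c.p ⊆ {a ∘ σ + β, b ∘ σ + β} := by
    intro y hy
    simp only [Finset.mem_image, Finset.mem_univ, true_and, exists_exists_eq_and] at hy
    obtain ⟨i, rfl⟩ := hy
    rw [← hs, hM, ← hback (α.mulVec (c'.p i)), ← hA]
    rcases hab i with h1 | h1 <;> rw [h1] <;> simp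
  have := Finset.card_le_card hsub
  rw [Finset.card_image_of_injective _ (p_inj hK c)] at this
  exact this.trans (Finset.card_le_two.trans (by omega))

noncomputable def conf (K : ℕ) : Config (K + 4) := Classical.choice (config_nonempty K)

noncomputable def Kseq : ℕ → ℕ
  | 0 => 0
  | n + 1 => Kseq n + (conf (Kseq n)).N + (conf (Kseq n)).k + 1

theorem Kseq_lt {m n : ℕ} (h : m < n) :
    Kseq m + (conf (Kseq m)).N + (conf (Kseq m)).k + 1 ≤ Kseq n := by
  induction n with
  | zero => omega
  | succ n ih =>
    rcases Nat.lt_succ_iff_lt_or_eq.mp h with h | rfl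
    · have := ih h
      simp only [Kseq]
      omega
    · simp only [Kseq]; omega

noncomputable def cf (n : ℕ) : Config (Kseq n + 4) := conf (Kseq n)

theorem cf_mem {m n : ℕ} (h : m ≠ n) : (cf n).F ∈ pPolSet (relP (cf m).p) := by
  rcases lt_or_gt_of_ne h with h | h
  · apply F_small
    have := Kseq_lt h
    unfold cf
    omega
  · apply F_large (by omega)
    have := Kseq_lt h
    unfold cf
    omega

/-- The strong partial clone attached to a set of indices. -/
def XS (S : Set ℕ) : Set (PF Bool) :=
  {f | f ∈ pPolSet relL ∧ ∀ n ∈ S, f ∈ pPolSet (relP (cf n).p)}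

theorem XS_mem (S : Set ℕ) : XS S ∈ Istr Lclone := by
  refine ⟨⟨?_, ?_⟩, ?_, ?_⟩
  · intro n i
    exact ⟨pPol_proj _ _ _, fun _ _ => pPol_proj _ _ _⟩
  · intro f hf m g hg
    exact ⟨pPol_comp _ f hf.1 m g (fun i => (hg i).1),
      fun n hn => pPol_comp _ f (hf.2 n hn) m g (fun i => (hg i).2 n hn)⟩
  · apply Set.Subset.antisymm
    · rintro f ⟨g, hg, hfg⟩
      exact ⟨pPol_restrict _ f g hg.1 hfg, fun n hn => pPol_restrict _ f g (hg.2 n hn) hfg⟩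
    · intro f hf
      exact ⟨f, hf, PFle_refl f⟩
  · apply Set.Subset.antisymm
    · rintro f ⟨hf, ht⟩
      exact ⟨hf.1, ht⟩
    · intro f hf
      exact ⟨⟨hf.1, fun n _ => L_sub_relP _ f hf⟩, hf.2⟩

theorem mem_XS (S : Set ℕ) (n : ℕ) : (cf n).F ∈ XS S ↔ n ∉ S := by
  constructor
  · intro h hn
    exact F_not_mem (by omega) (cf n) (h.2 n hn)
  · intro hn
    refine ⟨F_relL (by omega) _, fun m hm => cf_mem ?_⟩
    rintro rfl
    exact hn hm

theorem XS_injective : Function.Injective XS := by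
  intro S T h
  ext n
  rw [← not_iff_not, ← mem_XS, ← mem_XS, h]

theorem Istr_L_continuum : Cardinal.mk ↥(Istr Lclone) = Cardinal.continuum := by
  apply le_antisymm
  · have hc : Countable (PF Bool) := by unfold PF; infer_instance
    calc Cardinal.mk ↥(Istr Lclone) ≤ Cardinal.mk (Set (PF Bool)) := Cardinal.mk_set_le _
      _ = 2 ^ Cardinal.mk (PF Bool) := Cardinal.mk_set
      _ ≤ 2 ^ Cardinal.aleph0 := Cardinal.power_le_power_left two_ne_zero Cardinal.mk_le_aleph0
      _ = Cardinal.continuum := Cardinal.two_power_aleph0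
  · calc Cardinal.continuum = Cardinal.mk (Set ℕ) := by simp
      _ ≤ Cardinal.mk ↥(Istr Lclone) := Cardinal.mk_le_of_injective
          (f := fun S : Set ℕ => (⟨XS S, XS_mem S⟩ : ↥(Istr Lclone)))
          (fun S T h => XS_injective (congrArg Subtype.val h))

end StrongPartial
end

section
/- For every j ≥ 1, the partial function ξ_j preserves the relation ρ_1 and ξ_j preserves the relation ρ_C, i.e. ξ_j ∈ pPol ρ_1 and ξ_j ∈ pPol ρ_C. -/
namespace StrongPartial

variable {A : Type}

lemma tau_cases (k p : ℕ) (x : Fin ((tauPF k p).1 + 1) → Bool) (b : Bool)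
    (h : (tauPF k p).2 x = some b) :
    (b = true ∧ (∀ i, x i = true) ∧ ∑ i, (x i).toNat = (2 * k - 1) * p + 1) ∨
    (b = false ∧ ∑ i, (x i).toNat ≤ p) := by
  have hc : ∑ i, (x i).toNat = (Finset.univ.filter (fun i => x i = true)).card := by
    rw [Finset.card_filter]
    refine Finset.sum_congr rfl fun i _ => ?_
    cases x i <;> rfl
  have h' : (if ∀ i, x i = true then some true
    else if (Finset.univ.filter (fun i => x i = true)).card ≤ p then some false
    else none) = some b := h
  split_ifs at h' with h1 h2
  · left
    refine ⟨by simpa using h'.symm, h1, ?_⟩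
    have e : ∑ i, (x i).toNat = ∑ _i : Fin ((tauPF k p).1 + 1), 1 :=
      Finset.sum_congr rfl fun i _ => by rw [h1 i]; rfl
    rw [e]
    simp only [Finset.sum_const, Finset.card_univ, Fintype.card_fin, smul_eq_mul, mul_one]
    rfl
  · right
    exact ⟨by simpa using h'.symm, hc ▸ h2⟩

lemma mem_rho1 (v : Fin 4 → Bool) :
    v ∈ rho1 ↔ (v 0).toNat + (v 3).toNat = (v 1).toNat + (v 2).toNat := by
  have : v = ![v 0, v 1, v 2, v 3] := by ext i; fin_cases i <;> rfl
  rw [this]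
  generalize v 0 = a
  generalize v 1 = b
  generalize v 2 = c
  generalize v 3 = d
  cases a <;> cases b <;> cases c <;> cases d <;> simp [rho1, rhoC]

lemma mem_rhoC (v : Fin 4 → Bool) :
    v ∈ rhoC ↔ v ∈ rho1 ∧ (v 0 = true → v 1 = true ∧ v 2 = true) := by
  have : v = ![v 0, v 1, v 2, v 3] := by ext i; fin_cases i <;> rfl
  rw [this]
  generalize v 0 = a
  generalize v 1 = b
  generalize v 2 = c
  generalize v 3 = d
  cases a <;> cases b <;> cases c <;> cases d <;> simp [rho1, rhoC]

lemma tau_rho1 (k p : ℕ) (hk : 2 ≤ k) : Preserves (tauPF k p) rho1 := by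
  intro M v hM hv
  rw [mem_rho1]
  have hs : ∑ i, (M 0 i).toNat + ∑ i, (M 3 i).toNat
      = ∑ i, (M 1 i).toNat + ∑ i, (M 2 i).toNat := by
    rw [← Finset.sum_add_distrib, ← Finset.sum_add_distrib]
    exact Finset.sum_congr rfl fun i _ => (mem_rho1 _).1 (hM i)
  have hN : 3 * p ≤ (2 * k - 1) * p := Nat.mul_le_mul_right _ (by omega)
  rcases tau_cases k p _ _ (hv 0) with ⟨e0, -, h0⟩ | ⟨e0, h0⟩ <;>
  rcases tau_cases k p _ _ (hv 1) with ⟨e1, -, h1⟩ | ⟨e1, h1⟩ <;>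
  rcases tau_cases k p _ _ (hv 2) with ⟨e2, -, h2⟩ | ⟨e2, h2⟩ <;>
  rcases tau_cases k p _ _ (hv 3) with ⟨e3, -, h3⟩ | ⟨e3, h3⟩ <;>
  rw [e0, e1, e2, e3] <;> first | rfl | (exfalso; omega)

lemma tau_rhoC (k p : ℕ) (hk : 2 ≤ k) : Preserves (tauPF k p) rhoC := by
  intro M v hM hv
  have hM' := fun j => (mem_rhoC _).1 (hM j)
  refine (mem_rhoC v).2 ⟨tau_rho1 k p hk M v (fun j => (hM' j).1) hv, fun h => ?_⟩
  have full : ∀ r, (∀ i, M r i = true) → v r = true := by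
    intro r hr
    have h2 : (if ∀ i, M r i = true then some true
      else if (Finset.univ.filter (fun i => M r i = true)).card ≤ p then some false
      else none) = some (v r) := hv r
    rw [if_pos hr] at h2
    simpa using h2.symm
  rcases tau_cases k p _ _ (hv 0) with ⟨-, h0, -⟩ | ⟨e0, -⟩
  · exact ⟨full 1 fun i => ((hM' i).2 (h0 i)).1, full 2 fun i => ((hM' i).2 (h0 i)).2⟩
  · simp [e0] at h

theorem xi_preserves_rho1_rhoC (j : ℕ) (hj : 1 ≤ j) :
    Preserves (xi j) rho1 ∧ Preserves (xi j) rhoC := by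
  exact ⟨tau_rho1 _ _ (by omega), tau_rhoC _ _ (by omega)⟩

end StrongPartial
end

section
/- For every total clone D on 𝟚 with D ⊆ L, the interval I_str(D) has the cardinality of the continuum (2^{ℵ₀}). -/
namespace StrongPartial

variable {A : Type}

section
open Finset
theorem affine_of_add {D : ℕ} (F : (Fin D → ZMod 2) → ZMod 2)
    (h : ∀ x y, F (x + y) = F x + F y - F 0) :
    ∃ (a : Fin D → ZMod 2), ∀ x, F x = a ⬝ᵥ x + F 0 := by
  let G : (Fin D → ZMod 2) →+ ZMod 2 :=
    { toFun := fun x => F x - F 0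
      map_zero' := by simp
      map_add' := by intro x y; rw [h]; ring }
  let L := G.toZModLinearMap 2
  refine ⟨fun i => L (fun j => if i = j then 1 else 0), fun x => ?_⟩
  have h1 := LinearMap.pi_apply_eq_sum_univ L x
  have h2 : L x = F x - F 0 := rfl
  rw [← sub_eq_iff_eq_add, ← h2, h1]
  simp [dotProduct, mul_comm]

/-- bad sets of type A -/
theorem countA {D N : ℕ} (T : Finset (Fin N)) (hT : T.Nonempty) :
    (univ.filter (fun P : Fin N → (Fin D → ZMod 2) => ∑ i ∈ T, P i = 0)).card * 2 ^ D ≤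
      (2 ^ D) ^ N := by
  classical
  obtain ⟨i0, hi0⟩ := hT
  have hV : Fintype.card (Fin D → ZMod 2) = 2 ^ D := by simp [ZMod.card]
  have hPV : Fintype.card (Fin N → Fin D → ZMod 2) = (2 ^ D) ^ N := by
    rw [Fintype.card_fun, hV]; simp
  rw [← hPV]
  conv_lhs => rw [← hV, ← Finset.card_univ (α := (Fin D → ZMod 2)), ← Finset.card_product]
  rw [← Finset.card_univ]
  refine Finset.card_le_card_of_injOn (fun p => p.1 + Pi.single i0 p.2) (fun _ _ => mem_coe.2 (mem_univ _)) ?_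
  have key : ∀ P : Fin N → (Fin D → ZMod 2), ∀ w, ∑ i ∈ T, P i = 0 →
      ∑ i ∈ T, (P + Pi.single i0 w : Fin N → (Fin D → ZMod 2)) i = w := by
    intro P w h
    simp only [Pi.add_apply, Finset.sum_add_distrib, h, zero_add]
    rw [Finset.sum_eq_single_of_mem i0 hi0 (fun b _ hb => by simp [hb])]; simp
  rintro ⟨P, w⟩ h ⟨P', w'⟩ h' he
  simp only [coe_product, Set.mem_prod, mem_coe, mem_filter, mem_univ, true_and, and_true] at h h'
  simp only at he
  have e1 := key P w h
  rw [he, key P' w' h'] at e1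
  subst e1
  simpa using he

theorem countB {D N t : ℕ} (A : Fin t → (Fin D → ZMod 2)) (y : Fin D → ZMod 2) :
    ((univ.filter (fun P : Fin N → (Fin D → ZMod 2) =>
      ∀ i, ¬ ∀ e, A e ⬝ᵥ P i = A e ⬝ᵥ y)).card : ℝ) ≤ ((2 ^ D) * (1 - 1 / 2 ^ t)) ^ N := by
  classical
  have hV : Fintype.card (Fin D → ZMod 2) = 2 ^ D := by simp [ZMod.card]
  let S := univ.filter (fun x : Fin D → ZMod 2 => ¬ ∀ e, A e ⬝ᵥ x = A e ⬝ᵥ y)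
  let S' := univ.filter (fun x : Fin D → ZMod 2 => ∀ e, A e ⬝ᵥ x = A e ⬝ᵥ y)
  have h1 : (univ.filter (fun P : Fin N → (Fin D → ZMod 2) =>
      ∀ i, ¬ ∀ e, A e ⬝ᵥ P i = A e ⬝ᵥ y)) = Fintype.piFinset (fun _ : Fin N => S) := by
    ext P; simp [S]
  rw [h1, Fintype.card_piFinset]
  simp only [prod_const, card_univ, Fintype.card_fin, Nat.cast_pow]
  have h2 : S'.card + S.card = 2 ^ D := by
    rw [← hV, ← Finset.card_univ]; exact Finset.card_filter_add_card_filter_not _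
  have h3 : 2 ^ D ≤ S'.card * 2 ^ t := by
    have hW : Fintype.card (Fin t → ZMod 2) = 2 ^ t := by simp [ZMod.card]
    rw [← hV, ← Finset.card_univ, ← hW, ← Finset.card_univ (α := Fin t → ZMod 2)]
    refine Finset.card_le_mul_card_image_of_maps_to (f := fun x e => A e ⬝ᵥ x)
      (fun _ _ => mem_univ _) _ ?_
    intro b _
    by_cases hb : ∃ x0, (fun e => A e ⬝ᵥ x0) = b
    · obtain ⟨x0, rfl⟩ := hb
      refine Finset.card_le_card_of_injOn (fun x => x - x0 + y) ?_ ?_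
      · intro x hx
        simp only [coe_filter, mem_univ, true_and, Set.mem_ofPred_eq, S'] at hx ⊢
        intro e
        have := congrFun hx e
        rw [dotProduct_add, dotProduct_sub, this]; ring
      · intro x _ x' _ h
        simpa using h
    · rw [Finset.filter_eq_empty_iff.2]
      · simp
      · intro x _ hx
        exact hb ⟨x, hx⟩
  have h4 : (S.card : ℝ) ≤ 2 ^ D * (1 - 1 / 2 ^ t) := by
    have h2' : (S'.card : ℝ) + S.card = 2 ^ D := by exact_mod_cast h2
    have h3' : (2 : ℝ) ^ D ≤ S'.card * 2 ^ t := by exact_mod_cast h3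
    have : (2 : ℝ) ^ D * (1 / 2 ^ t) ≤ S'.card := by
      rw [mul_one_div, div_le_iff₀ (by positivity)]; exact h3'
    rw [mul_sub, mul_one]; linarith
  exact pow_le_pow_left₀ (by positivity) h4 N

theorem interp {D N : ℕ} (P : Fin N → (Fin D → ZMod 2)) (T : Finset (Fin N))
    (h : ∀ T' ⊆ T, T'.Nonempty → ∑ i ∈ T', P i ≠ 0) (v : Fin N → ZMod 2) :
    ∃ a : Fin D → ZMod 2, ∀ i ∈ T, v i = a ⬝ᵥ P i := by
  classical
  have hli : LinearIndependent (ZMod 2) (fun i : T => P i) := by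
    rw [Fintype.linearIndependent_iff]
    intro g hg i
    by_contra hi
    refine h ((univ.filter (fun i : T => g i ≠ 0)).map (Function.Embedding.subtype _)) ?_ ?_ ?_
    · intro j hj
      simp only [mem_map, mem_filter] at hj
      obtain ⟨a, _, rfl⟩ := hj
      exact a.2
    · exact ⟨i, by simp [hi]⟩
    · rw [Finset.sum_map, Finset.sum_filter]
      refine Eq.trans (Finset.sum_congr rfl fun j _ => ?_) hg
      have : ∀ z : ZMod 2, z ≠ 0 → z = 1 := by decide
      split_ifs with hj
      · rw [this _ hj]; simp
      · rw [not_not.1 hj]; simp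
  obtain ⟨g, hg⟩ := LinearMap.exists_leftInverse_of_injective
    (Finsupp.linearCombination (ZMod 2) (fun i : T => P i)) (LinearMap.ker_eq_bot.2 hli)
  let L := (Finsupp.linearCombination (ZMod 2) (fun i : T => v i)).comp g
  obtain ⟨a, ha⟩ := affine_of_add (fun x => L x) (by intro x y; simp)
  refine ⟨a, fun i hi => ?_⟩
  have h1 := ha (P i)
  simp only [map_zero, add_zero] at h1
  rw [← h1]
  have h2 := LinearMap.congr_fun hg (Finsupp.single ⟨i, hi⟩ 1)
  simp only [LinearMap.comp_apply, Finsupp.linearCombination_single, one_smul, LinearMap.id_apply] at h2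
  simp only [L, LinearMap.comp_apply, h2, Finsupp.linearCombination_single, one_smul]

theorem asymp (t K : ℕ) : ∃ D : ℕ, 1 ≤ D ∧ ((t + 1 : ℕ) : ℝ) * (D * K : ℕ) ^ t + 1 < 2 ^ D := by
  have h1 := (tendsto_pow_const_div_const_pow_of_one_lt t (r := 2) (by norm_num)).const_mul
    (((t + 1 : ℕ) : ℝ) * K ^ t)
  have h2 := (tendsto_pow_const_div_const_pow_of_one_lt 0 (r := 2) (by norm_num))
  have h3 := h1.add h2
  simp only [mul_zero, add_zero] at h3
  have h4 := (h3.eventually (gt_mem_nhds (zero_lt_one))).and (Filter.eventually_ge_atTop 1)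
  obtain ⟨D, hD, hD1⟩ := h4.exists
  refine ⟨D, hD1, ?_⟩
  rw [← mul_div_assoc, ← add_div, div_lt_one (by positivity)] at hD
  push_cast at hD ⊢
  rw [mul_pow]
  simp only [pow_zero] at hD
  linarith

def CA {D N : ℕ} (t : ℕ) (P : Fin N → (Fin D → ZMod 2)) : Prop :=
  ∀ T : Finset (Fin N), T.card ≤ t → ∀ v : Fin N → ZMod 2,
    ∃ a : Fin D → ZMod 2, ∀ i ∈ T, v i = a ⬝ᵥ P i

def CB {D N : ℕ} (t : ℕ) (P : Fin N → (Fin D → ZMod 2)) : Prop :=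
  ∀ (A : Fin t → (Fin D → ZMod 2)) (y : Fin D → ZMod 2), ∃ i, ∀ e, A e ⬝ᵥ P i = A e ⬝ᵥ y

theorem exists_code (t : ℕ) : ∃ (N D : ℕ) (P : Fin N → (Fin D → ZMod 2)),
    D + 1 < N ∧ CA t P ∧ CB t P := by
  classical
  set q : ℝ := 1 - 1 / 2 ^ t with hq
  have hq0 : 0 ≤ q := by
    rw [hq, sub_nonneg, div_le_one (by positivity)]; exact one_le_pow₀ (by norm_num)
  have hq1 : q < 1 := by
    rw [hq]; have : (0:ℝ) < 1 / 2 ^ t := by positivity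
    linarith
  obtain ⟨K0, hK0⟩ := exists_pow_lt_of_lt_one (show (0:ℝ) < (1 / 2) ^ (t + 2) by positivity) hq1
  set K := K0 + 3
  have hK : q ^ K ≤ (1 / 2) ^ (t + 2) :=
    (pow_le_pow_of_le_one hq0 hq1.le (by omega)).trans hK0.le
  obtain ⟨D, hD1, hD⟩ := asymp t K
  set N := D * K with hN
  have hDN : D + 1 < N := by
    have : D * 3 ≤ N := Nat.mul_le_mul_left _ (by omega)
    omega
  have hV : Fintype.card (Fin D → ZMod 2) = 2 ^ D := by simp [ZMod.card]
  have hPV : Fintype.card (Fin N → Fin D → ZMod 2) = (2 ^ D) ^ N := by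
    rw [Fintype.card_fun, hV]; simp
  let badA : Finset (Fin N → Fin D → ZMod 2) :=
    (range (t + 1)).biUnion fun r => (powersetCard r (univ : Finset (Fin N))).biUnion fun T =>
      if T.Nonempty then univ.filter (fun P => ∑ i ∈ T, P i = 0) else ∅
  let badB : Finset (Fin N → Fin D → ZMod 2) :=
    (univ : Finset ((Fin t → (Fin D → ZMod 2)) × (Fin D → ZMod 2))).biUnion fun p =>
      univ.filter (fun P => ∀ i, ¬ ∀ e, p.1 e ⬝ᵥ P i = p.1 e ⬝ᵥ p.2)
  have hA : (badA.card : ℝ) * 2 ^ D ≤ ((t + 1 : ℕ) : ℝ) * (N : ℝ) ^ t * (2 ^ D) ^ N := by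
    have : badA.card * 2 ^ D ≤ (t + 1) * N ^ t * (2 ^ D) ^ N := by
      calc badA.card * 2 ^ D ≤ (∑ r ∈ range (t + 1), ∑ T ∈ powersetCard r (univ : Finset (Fin N)),
          (if T.Nonempty then univ.filter (fun P : Fin N → Fin D → ZMod 2 => ∑ i ∈ T, P i = 0)
            else ∅).card) * 2 ^ D := by
            refine Nat.mul_le_mul_right _ (card_biUnion_le.trans ?_)
            exact Finset.sum_le_sum fun r _ => card_biUnion_le
        _ = ∑ r ∈ range (t + 1), ∑ T ∈ powersetCard r (univ : Finset (Fin N)),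
          (if T.Nonempty then univ.filter (fun P : Fin N → Fin D → ZMod 2 => ∑ i ∈ T, P i = 0)
            else ∅).card * 2 ^ D := by
            rw [Finset.sum_mul]; refine Finset.sum_congr rfl fun _ _ => ?_
            rw [Finset.sum_mul]
        _ ≤ ∑ r ∈ range (t + 1), ∑ T ∈ powersetCard r (univ : Finset (Fin N)), (2 ^ D) ^ N := by
            refine Finset.sum_le_sum fun r _ => Finset.sum_le_sum fun T _ => ?_
            split_ifs with hT
            · exact countA T hT
            · simp
        _ ≤ ∑ r ∈ range (t + 1), N ^ t * (2 ^ D) ^ N := by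
            refine Finset.sum_le_sum fun r hr => ?_
            rw [Finset.sum_const, card_powersetCard, card_univ, Fintype.card_fin, smul_eq_mul]
            refine Nat.mul_le_mul_right _ ((Nat.choose_le_pow _ _).trans ?_)
            exact Nat.pow_le_pow_right (by omega) (by simp at hr; omega)
        _ = _ := by simp [mul_assoc]
    exact_mod_cast this
  have hB : (badB.card : ℝ) * 2 ^ D ≤ (2 ^ D) ^ N := by
    have h1 : (badB.card : ℝ) ≤ (2 ^ D) ^ (t + 1) * (2 ^ D * q) ^ N := by
      have h0 : badB.card ≤ ∑ p : (Fin t → (Fin D → ZMod 2)) × (Fin D → ZMod 2),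
        (univ.filter (fun P : Fin N → Fin D → ZMod 2 =>
          ∀ i, ¬ ∀ e, p.1 e ⬝ᵥ P i = p.1 e ⬝ᵥ p.2)).card := card_biUnion_le
      calc (badB.card : ℝ) ≤ ∑ p : (Fin t → (Fin D → ZMod 2)) × (Fin D → ZMod 2),
        ((univ.filter (fun P : Fin N → Fin D → ZMod 2 =>
          ∀ i, ¬ ∀ e, p.1 e ⬝ᵥ P i = p.1 e ⬝ᵥ p.2)).card : ℝ) := by exact_mod_cast h0
        _ ≤ ∑ p : (Fin t → (Fin D → ZMod 2)) × (Fin D → ZMod 2), (2 ^ D * q) ^ N :=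
          Finset.sum_le_sum fun p _ => countB p.1 p.2
        _ = _ := by
          rw [Finset.sum_const, card_univ, Fintype.card_prod, Fintype.card_fun, hV,
            Fintype.card_fin, nsmul_eq_mul]
          push_cast; ring
    have h2 : q ^ N ≤ (1 / (2 ^ D) ^ (t + 2) : ℝ) := by
      rw [hN, mul_comm D K, pow_mul]
      refine (pow_le_pow_left₀ (by positivity) hK D).trans (le_of_eq ?_)
      rw [one_div_pow, one_div_pow, ← pow_mul, ← pow_mul, mul_comm]
    calc (badB.card : ℝ) * 2 ^ D ≤ (2 ^ D) ^ (t + 1) * (2 ^ D * q) ^ N * 2 ^ D := by gcongr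
      _ = (2 ^ D) ^ N * ((2 ^ D) ^ (t + 2) * q ^ N) := by rw [mul_pow]; ring
      _ ≤ (2 ^ D) ^ N * ((2 ^ D) ^ (t + 2) * (1 / (2 ^ D) ^ (t + 2))) := by gcongr
      _ = (2 ^ D) ^ N := by rw [mul_one_div_cancel (by positivity), mul_one]
  have hlt : (badA ∪ badB).card < Fintype.card (Fin N → Fin D → ZMod 2) := by
    rw [hPV]
    refine (Finset.card_union_le _ _).trans_lt ?_
    have : ((badA.card : ℝ) + badB.card) * 2 ^ D < (2 ^ D) ^ N * 2 ^ D := by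
      calc ((badA.card : ℝ) + badB.card) * 2 ^ D ≤
          (2 ^ D) ^ N * (((t + 1 : ℕ) : ℝ) * (N : ℝ) ^ t + 1) := by linarith
        _ < _ := by gcongr
    have := lt_of_mul_lt_mul_right this (by positivity)
    exact_mod_cast this
  obtain ⟨P, hP⟩ : ∃ P, P ∉ badA ∪ badB := by
    by_contra hcon
    push Not at hcon
    rw [(Finset.eq_univ_iff_forall).2 hcon, card_univ] at hlt
    exact lt_irrefl _ hlt
  rw [mem_union, not_or] at hP
  refine ⟨N, D, P, hDN, ?_, ?_⟩
  · intro T hT v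
    refine interp P T ?_ v
    intro T' hT' hne h0
    apply hP.1
    simp only [badA, mem_biUnion, mem_range, mem_powersetCard]
    refine ⟨T'.card, by have := card_le_card hT'; omega, T', ⟨subset_univ _, rfl⟩, ?_⟩
    rw [if_pos hne]; simpa using h0
  · intro A y
    by_contra hcon
    apply hP.2
    simp only [badB, mem_biUnion, mem_univ, true_and, mem_filter]
    exact ⟨(A, y), fun i hi => hcon ⟨i, hi⟩⟩

end


def tz (b : Bool) : ZMod 2 := if b then 1 else 0

def tb (z : ZMod 2) : Bool := decide (z = 1)

theorem tz_tb (z : ZMod 2) : tz (tb z) = z := by revert z; decide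

theorem tb_tz (b : Bool) : tb (tz b) = b := by revert b; decide

theorem tz_inj {a b : Bool} (h : tz a = tz b) : a = b := by revert a b; decide

theorem mem_relL (v : Fin 4 → Bool) :
    v ∈ relL ↔ tz (v 0) + tz (v 1) + tz (v 2) + tz (v 3) = 0 := by
  have hv : v = ![v 0, v 1, v 2, v 3] := by
    funext i; fin_cases i <;> rfl
  constructor
  · rintro ⟨x, y, h | h | h⟩ <;> rw [h] <;> clear h <;> revert x y <;> decide
  · intro h
    rw [hv]
    generalize v 0 = a at h ⊢
    generalize v 1 = b at h ⊢
    generalize v 2 = c at h ⊢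
    generalize v 3 = d at h ⊢
    show ∃ x y : Bool, _
    revert a b c d
    decide

/-- Local closure -/
def Loc (h : ℕ) (D : Set (PF Bool)) : Set (PF Bool) :=
  {f | ∀ (x : Fin h → Fin (f.1 + 1) → Bool) (v : Fin h → Bool), (∀ j, f.2 (x j) = some (v j)) →
    ∃ d : (Fin (f.1 + 1) → Bool) → Option Bool, (⟨f.1, d⟩ : PF Bool) ∈ D ∧
      ∀ j, d (x j) = some (v j)}

theorem compFun_eq_some {k m : ℕ} {f : (Fin k → A) → Option A}
    {g : Fin k → ((Fin m → A) → Option A)} {x : Fin m → A} {a : A} :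
    compFun f g x = some a ↔ ∃ y : Fin k → A, (∀ i, g i x = some (y i)) ∧ f y = some a := by
  unfold compFun
  constructor
  · intro h
    split_ifs at h with h1
    exact ⟨_, fun i => by simp, h⟩
  · rintro ⟨y, hy, h⟩
    have h1 : ∀ i, (g i x).isSome := fun i => by simp [hy]
    rw [dif_pos h1, ← h]
    congr 1
    funext i
    simp [hy]

theorem strong_of {X : Set (PF Bool)} (h : ∀ (n : ℕ) (f g : (Fin (n + 1) → Bool) → Option Bool),
    (⟨n, g⟩ : PF Bool) ∈ X → (∀ x a, f x = some a → g x = some a) → (⟨n, f⟩ : PF Bool) ∈ X) :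
    IsStrong X := by
  apply Set.Subset.antisymm
  · rintro ⟨n, f⟩ ⟨⟨m, g⟩, hg, he, hle⟩
    dsimp only at he
    subst he
    exact h n f g hg hle
  · intro f hf
    exact ⟨f, hf, rfl, fun x a h => h⟩

theorem loc_clone {h : ℕ} {D : Set (PF Bool)} (hD : IsPartialClone D) :
    IsPartialClone (Loc h D) := by
  refine ⟨fun n i x v hx => ⟨(proj n i : PF Bool).2, hD.1 n i, hx⟩, ?_⟩
  intro f hf m g hg x v hx
  have h1 := fun j => compFun_eq_some.1 (hx j)
  choose y hy hfy using h1
  have h2 := fun i => hg i x (fun j => y j i) (fun j => hy j i)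
  choose d hdD hd using h2
  obtain ⟨e, heD, he⟩ := hf y v hfy
  exact ⟨compFun e d, hD.2 ⟨f.1, e⟩ heD m d hdD, fun j => compFun_eq_some.2 ⟨y j, fun i => hd i j, he j⟩⟩

theorem ppol_clone {h : ℕ} (ρ : Set (Fin h → Bool)) : IsPartialClone (pPolSet ρ) := by
  constructor
  · intro n i M v hM hv
    have : v = fun j => M j i := by
      funext j
      have := hv j
      simp only [proj, Option.some.injEq] at this
      exact this.symm
    rw [this]; exact hM i
  · intro f hf m g hg M v hM hv
    have h1 := fun j => compFun_eq_some.1 (hv j)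
    choose y hy hfy using h1
    exact hf y v (fun i => hg i M (fun j => y j i) hM (fun j => hy j i)) hfy

theorem L_add {n : ℕ} {f : (Fin (n + 1) → Bool) → Option Bool} (hf : (⟨n, f⟩ : PF Bool) ∈ Lclone) :
    ∃ (α : Fin (n + 1) → ZMod 2) (β : ZMod 2),
      ∀ x v, f x = some v → tz v = α ⬝ᵥ (fun j => tz (x j)) + β := by
  obtain ⟨hp, ht⟩ := hf
  have ht' : ∀ x, ∃ v, f x = some v := fun x => Option.isSome_iff_exists.1 (ht x)
  choose F hF using ht'
  let G : (Fin (n + 1) → ZMod 2) → ZMod 2 := fun x => tz (F (fun j => tb (x j)))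
  obtain ⟨α, hα⟩ := affine_of_add G (by
    intro x y
    have h1 := hp ![fun j => tb ((x + y) j), fun j => tb (x j), fun j => tb (y j), fun j => tb 0]
      ![F (fun j => tb ((x + y) j)), F (fun j => tb (x j)), F (fun j => tb (y j)), F (fun j => tb 0)]
      (by
        intro j
        rw [mem_relL]
        simp only [Matrix.cons_val, tz_tb, Pi.add_apply]
        generalize x j = a
        generalize y j = b
        revert a b; decide)
      (by intro i; fin_cases i <;> exact hF _)
    rw [mem_relL] at h1
    simp only [Matrix.cons_val] at h1
    change G (x + y) + G x + G y + G 0 = 0 at h1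
    generalize G (x + y) = a at h1 ⊢
    generalize G x = b at h1 ⊢
    generalize G y = c at h1 ⊢
    generalize G 0 = d at h1 ⊢
    revert a b c d
    decide)
  refine ⟨α, G 0, fun x v hv => ?_⟩
  rw [← hα]
  simp only [G, tb_tz]
  rw [hF] at hv
  rw [Option.some.inj hv]

def tot (n : ℕ) (F : (Fin (n + 1) → Bool) → Bool) : PF Bool := ⟨n, fun x => some (F x)⟩

theorem comp_tot {X : Set (PF Bool)} (hX : IsPartialClone X) {k m : ℕ}
    {F : (Fin (k + 1) → Bool) → Bool} {G : Fin (k + 1) → (Fin (m + 1) → Bool) → Bool}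
    (hF : tot k F ∈ X) (hG : ∀ i, tot m (G i) ∈ X) : tot m (fun x => F (fun i => G i x)) ∈ X := by
  have h := hX.2 _ hF m (fun i x => some (G i x)) hG
  have e : tot m (fun x => F (fun i => G i x)) =
      ⟨m, compFun (tot k F).2 (fun i x => some (G i x))⟩ := by
    unfold tot
    congr 1
    funext x
    exact (compFun_eq_some.2 ⟨fun i => G i x, fun i => rfl, rfl⟩).symm
  rw [e]; exact h

theorem minor_tot {X : Set (PF Bool)} (hX : IsPartialClone X) {k m : ℕ}
    {F : (Fin (k + 1) → Bool) → Bool} (σ : Fin (k + 1) → Fin (m + 1))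
    (hF : tot k F ∈ X) : tot m (fun x => F (x ∘ σ)) ∈ X :=
  comp_tot hX (G := fun i x => x (σ i)) hF (fun i => hX.1 m (σ i))

theorem lin_mem {D : Set (PF Bool)} (hD : IsPartialClone D) : ∀ (r n : ℕ)
    (F : (Fin (n + 1) → Bool) → Bool) (α : Fin (n + 1) → ZMod 2) (β : ZMod 2),
    (∀ x, tz (F x) = α ⬝ᵥ (fun j => tz (x j)) + β) →
    (Finset.univ.filter (fun j => α j ≠ 0)).card ≤ r →
    (∀ σ : Fin (n + 1) → Fin 3, tot 2 (fun y => F (y ∘ σ)) ∈ D) → tot n F ∈ D := by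
  intro r
  induction r with
  | zero =>
    intro n F α β hF hr hσ
    have h0 : ∀ j, α j = 0 := by
      intro j
      by_contra hj
      have : j ∈ Finset.univ.filter (fun j => α j ≠ 0) := by simp [hj]
      have := Finset.card_pos.2 ⟨j, this⟩
      omega
    have h := minor_tot hD (fun _ : Fin 3 => (0 : Fin (n + 1))) (hσ (fun _ => 0))
    convert h using 2
    funext x
    apply tz_inj
    rw [hF, hF]
    simp [dotProduct, h0]
  | succ r ih =>
    intro n F α β hF hr hσ
    by_cases h3 : (Finset.univ.filter (fun j => α j ≠ 0)).card ≤ 3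
    · obtain ⟨e⟩ : Nonempty ({j // α j ≠ 0} ↪ Fin 3) :=
        Function.Embedding.nonempty_of_card_le (by rw [Fintype.card_subtype]; simpa using h3)
      classical
      let σ : Fin (n + 1) → Fin 3 := fun j => if h : α j ≠ 0 then e ⟨j, h⟩ else 0
      let τ : Fin 3 → Fin (n + 1) := fun k => if h : ∃ j, e j = k then h.choose.1 else 0
      have hτ : ∀ j, α j ≠ 0 → τ (σ j) = j := by
        intro j hj
        simp only [σ, dif_pos hj, τ]
        have h : ∃ j', e j' = e ⟨j, hj⟩ := ⟨_, rfl⟩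
        rw [dif_pos h, e.injective h.choose_spec]
      have h := minor_tot hD τ (hσ σ)
      convert h using 2
      funext x
      apply tz_inj
      rw [hF, hF]
      congr 1
      refine Finset.sum_congr rfl fun j _ => ?_
      by_cases hj : α j = 0
      · simp [hj]
      · simp [hτ j hj]
    · push Not at h3
      obtain ⟨i1, i2, i3, m1, m2, m3, h12, h13, h23⟩ := Finset.two_lt_card_iff.1 
        (show 2 < (Finset.univ.filter (fun j => α j ≠ 0)).card by omega)
      simp only [Finset.mem_filter, Finset.mem_univ, true_and] at m1 m2 m3
      have one : ∀ z : ZMod 2, z ≠ 0 → z = 1 := by decide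
      replace m1 := one _ m1
      replace m2 := one _ m2
      replace m3 := one _ m3
      -- the ternary sum
      have hT : tot 2 (fun y => tb (tz (y 0) + tz (y 1) + tz (y 2))) ∈ D := by
        have hm := hσ (fun j => if j = i1 then 0 else if j = i2 then 1 else 2)
        set m : (Fin 3 → Bool) → Bool := fun y =>
          F (y ∘ (fun j => if j = i1 then 0 else if j = i2 then 1 else 2)) with hmdef
        have hmz : ∀ y, tz (m y) = β + tz (y 0) + tz (y 1) + (∑ j, α j) * tz (y 2) := by
          intro y
          rw [hmdef]
          simp only [hF]
          have e : (fun j => tz ((y ∘ (fun j => if j = i1 then 0 else if j = i2 then 1 else 2)) j)) =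
            (fun _ : Fin (n + 1) => tz (y 2)) + Pi.single i1 (tz (y 0) + tz (y 2)) +
              Pi.single i2 (tz (y 1) + tz (y 2)) := by
            funext j
            simp only [Function.comp, Pi.add_apply]
            have two : ∀ a b : ZMod 2, a = b + (a + b) := by decide
            by_cases hj1 : j = i1
            · subst hj1; simpa [h12] using two _ _
            · by_cases hj2 : j = i2
              · subst hj2; simpa [h12, hj1] using two _ _
              · simp [hj1, hj2]
          rw [e, dotProduct_add, dotProduct_add, dotProduct_single, dotProduct_single, m1, m2]
          have : α ⬝ᵥ (fun _ : Fin (n + 1) => tz (y 2)) = (∑ j, α j) * tz (y 2) := by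
            simp [dotProduct, Finset.sum_mul]
          rw [this]
          generalize (∑ j, α j) * tz (y 2) = s
          generalize tz (y 0) = a
          generalize tz (y 1) = b
          generalize tz (y 2) = c
          clear hF
          revert s a b c β
          decide
        have h2 : ∀ z : ZMod 2, z = 0 ∨ z = 1 := by decide
        rcases h2 (∑ j, α j) with hs | hs
        · have h := comp_tot hD (F := m) (G := fun i : Fin 3 => if i = 0 then m else fun y => y 2) hm
            (by
              intro i
              by_cases hi : i = 0
              · simp only [hi, if_true]; exact hm
              · simp only [hi, if_false]; exact hD.1 2 2)
          convert h using 2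
          funext y
          apply tz_inj
          rw [hmz, tz_tb]
          simp only [if_true, hmz, hs, zero_mul]
          simp only [Fin.isValue, one_ne_zero, if_false]
          generalize tz (y 0) = a
          generalize tz (y 1) = b
          generalize tz (y 2) = c
          clear hF hmz
          revert a b c β
          decide
        · have h := comp_tot hD (F := m) (G := fun i : Fin 3 => m) hm (fun _ => hm)
          convert h using 2
          funext y
          apply tz_inj
          rw [hmz, tz_tb]
          simp only [hmz, hs]
          generalize tz (y 0) = a
          generalize tz (y 1) = b
          generalize tz (y 2) = c
          clear hF hmz
          revert a b c β
          decide
      -- the smaller function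
      let ρ : Fin (n + 1) → Fin (n + 1) := fun j => if j = i1 then i2 else j
      let α' : Fin (n + 1) → ZMod 2 := α + Pi.single i1 1 + Pi.single i2 1
      have hα' : ∀ z : Fin (n + 1) → ZMod 2, α' ⬝ᵥ z = α ⬝ᵥ z + z i1 + z i2 := by
        intro z
        simp only [α', add_dotProduct, single_dotProduct, one_mul]
      have hG : tot n (fun x => F (x ∘ ρ)) ∈ D := by
        refine ih n _ α' β ?_ ?_ ?_
        · intro x
          rw [hF, hα']
          have e : (fun j => tz ((x ∘ ρ) j)) =
            (fun j => tz (x j)) + Pi.single i1 (tz (x i1) + tz (x i2)) := by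
            funext j
            have two : ∀ a b : ZMod 2, a = b + (b + a) := by decide
            simp only [Function.comp, Pi.add_apply, ρ]
            by_cases hj1 : j = i1
            · subst hj1; simpa using two _ _
            · simp [hj1]
          rw [e, dotProduct_add, dotProduct_single, m1]
          ring
        · have : (Finset.univ.filter (fun j => α' j ≠ 0)) ⊂
              (Finset.univ.filter (fun j => α j ≠ 0)) := by
            rw [Finset.ssubset_iff_of_subset]
            · refine ⟨i1, by simp [m1], ?_⟩
              have : (1 : ZMod 2) + 1 = 0 := by decide
              simp [α', m1, h12, this]
            · intro j
              simp only [Finset.mem_filter, Finset.mem_univ, true_and]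
              intro h hj
              apply h
              have n1 : j ≠ i1 := by rintro rfl; simp [hj] at m1
              have n2 : j ≠ i2 := by rintro rfl; simp [hj] at m2
              simp [α', hj, n1, n2]
          have := Finset.card_lt_card this
          omega
        · intro σ
          have := hσ (σ ∘ ρ)
          exact this
      have hT' : tot n (fun x => tb (tz (x i1) + tz (x i2) + tz (x i3))) ∈ D :=
        minor_tot hD (![i1, i2, i3] : Fin 3 → Fin (n + 1)) hT
      have h := comp_tot hD (G := fun i => if i = i3 then
          (fun x => tb (tz (x i1) + tz (x i2) + tz (x i3))) else fun x => x i) hG (by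
            intro i
            by_cases hi : i = i3
            · simp only [hi, if_true]; exact hT'
            · simp only [hi, if_false]; exact hD.1 n i)
      convert h using 2
      funext x
      apply tz_inj
      rw [hF, hF]
      congr 1
      have e : (fun j => tz (((fun i => (if i = i3 then
          (fun x : Fin (n + 1) → Bool => tb (tz (x i1) + tz (x i2) + tz (x i3)))
            else fun x => x i) x) ∘ ρ) j)) =
          (fun j => tz (x j)) + Pi.single i1 (tz (x i1) + tz (x i2)) +
            Pi.single i3 (tz (x i1) + tz (x i2)) := by
        funext j
        have two : ∀ a b : ZMod 2, a = b + (b + a) := by decide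
        simp only [Function.comp, Pi.add_apply, ρ]
        by_cases hj1 : j = i1
        · subst hj1; simpa [h13, h23] using two _ _
        · by_cases hj3 : j = i3
          · subst hj3; simp [hj1, tz_tb]; ring
          · simp [hj1, hj3]
      rw [e, dotProduct_add, dotProduct_add, dotProduct_single, dotProduct_single, m1, m3]
      have two : ∀ a b : ZMod 2, a = a + 1 * b + 1 * b := by decide
      exact two _ _

theorem loc_total {D : Set (PF Bool)} (hD : IsClone D) (hDL : D ⊆ Lclone) :
    Loc 8 D ∩ OSet Bool = D := by
  apply Set.Subset.antisymm
  · rintro ⟨n, f⟩ ⟨hf, ht⟩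
    have hL : (⟨n, f⟩ : PF Bool) ∈ Lclone := by
      refine ⟨?_, ht⟩
      intro M v hM hv
      obtain ⟨d, hd, hd'⟩ := hf (fun j => M ⟨j.1 % 4, Nat.mod_lt _ (by norm_num)⟩)
        (fun j => v ⟨j.1 % 4, Nat.mod_lt _ (by norm_num)⟩) (fun j => hv _)
      refine (hDL hd).1 M v hM ?_
      intro i
      have := hd' ⟨i.1, by omega⟩
      have e : (⟨i.1 % 4, Nat.mod_lt _ (by norm_num)⟩ : Fin 4) = i := by
        apply Fin.ext; exact Nat.mod_eq_of_lt i.2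
      simp only [e] at this
      exact this
    obtain ⟨α, β, hαβ⟩ := L_add hL
    have ht' : ∀ x, ∃ v, f x = some v := fun x => Option.isSome_iff_exists.1 (ht x)
    choose F hF using ht'
    have hfF : (⟨n, f⟩ : PF Bool) = tot n F := by
      unfold tot; congr 1; funext x; exact hF x
    rw [hfF]
    refine lin_mem hD.1 _ n F α β (fun x => hαβ x _ (hF x)) le_rfl ?_
    intro σ
    let E : Fin 8 ≃ (Fin 3 → Bool) := (Fintype.equivFinOfCardEq (by simp)).symm
    obtain ⟨d, hd, hd'⟩ := hf (fun j => E j ∘ σ) (fun j => F (E j ∘ σ)) (fun j => hF _)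
    have ht' : ∀ x, ∃ v, d x = some v := fun x => Option.isSome_iff_exists.1 (hD.2 hd x)
    choose G hG using ht'
    have hdG : (⟨n, d⟩ : PF Bool) = tot n G := by
      unfold tot; congr 1; funext x; exact hG x
    simp only at hd
    rw [hdG] at hd
    have := minor_tot hD.1 σ hd
    convert this using 2
    funext y
    have h := hd' (E.symm y)
    simp only [Equiv.apply_symm_apply] at h
    rw [hG] at h
    exact (Option.some.inj h).symm
  · intro f hf
    exact ⟨fun x v hv => ⟨f.2, hf, hv⟩, hD.2 hf⟩

def RR {D N : ℕ} (P : Fin N → (Fin D → ZMod 2)) : Set (Fin N → Bool) :=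
  {x | ∃ (a : Fin D → ZMod 2) (b : ZMod 2), ∀ i, tz (x i) = a ⬝ᵥ P i + b}

theorem L_pres {D N : ℕ} (P : Fin N → (Fin D → ZMod 2)) {f : PF Bool} (hf : f ∈ Lclone) :
    f ∈ pPolSet (RR P) := by
  obtain ⟨n, f⟩ := f
  obtain ⟨α, β, hα⟩ := L_add hf
  intro M v hM hv
  choose a b hab using hM
  refine ⟨∑ j, α j • a j, ∑ j, α j * b j + β, fun i => ?_⟩
  rw [hα _ _ (hv i), ← add_assoc]
  congr 1
  rw [sum_dotProduct, ← Finset.sum_add_distrib]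
  refine Finset.sum_congr rfl fun j _ => ?_
  show α j * tz (M i j) = _
  rw [show tz (M i j) = a j ⬝ᵥ P i + b j from hab j i, smul_dotProduct, smul_eq_mul]
  ring

theorem RR_ne {D N : ℕ} (P : Fin N → (Fin D → ZMod 2)) (h : D + 1 < N) : ∃ v, v ∉ RR P := by
  by_contra hcon
  push Not at hcon
  let g : (Fin D → ZMod 2) × ZMod 2 → (Fin N → Bool) := fun p i => tb (p.1 ⬝ᵥ P i + p.2)
  have hg : Function.Surjective g := by
    intro x
    obtain ⟨a, b, hab⟩ := hcon x
    refine ⟨(a, b), ?_⟩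
    funext i
    simp only [g]
    rw [← hab, tb_tz]
  have := Fintype.card_le_of_surjective g hg
  simp only [Fintype.card_fun, Fintype.card_bool, Fintype.card_fin, Fintype.card_prod,
    ZMod.card] at this
  rw [← pow_succ] at this
  have := (Nat.pow_le_pow_iff_right (by norm_num)).1 this
  omega

theorem hom_small {D N D' N' : ℕ} (P : Fin N → (Fin D → ZMod 2)) (P' : Fin N' → (Fin D' → ZMod 2))
    (hA : CA N P') (φ : Fin N → Fin N') (hφ : ∀ c ∈ RR P', (fun i => c (φ i)) ∈ RR P)
    (v : Fin N' → Bool) : (fun i => v (φ i)) ∈ RR P := by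
  classical
  obtain ⟨a, ha⟩ := hA (Finset.univ.image φ) (Finset.card_image_le.trans (by simp)) (fun i => tz (v i))
  have h := hφ (fun i => tb (a ⬝ᵥ P' i)) ⟨a, 0, fun i => by rw [tz_tb, add_zero]⟩
  convert h using 2 with i
  rw [← ha (φ i) (by simp), tb_tz]

theorem hom_big {D N D' N' s : ℕ} (P : Fin N → (Fin D → ZMod 2)) (P' : Fin N' → (Fin D' → ZMod 2))
    (hB : CB s P) (hs : D' ≤ s) (hA : CA 4 P')
    (φ : Fin N → Fin N') (hφ : ∀ c ∈ RR P', (fun i => c (φ i)) ∈ RR P)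
    (v : Fin N' → Bool) : (fun i => v (φ i)) ∈ RR P := by
  classical
  have h1 : ∀ e : Fin D', ∃ (a : Fin D → ZMod 2) (b : ZMod 2), ∀ i, P' (φ i) e = a ⬝ᵥ P i + b := by
    intro e
    obtain ⟨a, b, hab⟩ := hφ (fun i => tb (P' i e))
      ⟨Pi.single e 1, 0, fun i => by rw [tz_tb, single_dotProduct]; simp⟩
    exact ⟨a, b, fun i => by rw [← hab, tz_tb]⟩
  choose a b hab using h1
  have h2 : ∀ y : Fin D → ZMod 2, ∃ i, ∀ e, a e ⬝ᵥ P i = a e ⬝ᵥ y := by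
    intro y
    obtain ⟨i, hi⟩ := hB (fun e => if h : e.1 < D' then a ⟨e.1, h⟩ else 0) y
    refine ⟨i, fun e => ?_⟩
    have := hi ⟨e.1, by omega⟩
    simpa using this
  choose ι hι using h2
  have hP : ∀ y e, P' (φ (ι y)) e = a e ⬝ᵥ y + b e := by
    intro y e
    rw [hab, hι]
  obtain ⟨α, hα⟩ := affine_of_add (fun y => tz (v (φ (ι y)))) (by
    intro x y
    obtain ⟨c, hc⟩ := hA {φ (ι (x + y)), φ (ι x), φ (ι y), φ (ι 0)} Finset.card_le_four
      (fun i => tz (v i))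
    try simp only
    rw [hc (φ (ι (x + y))) (by simp), hc (φ (ι x)) (by simp), hc (φ (ι y)) (by simp),
      hc (φ (ι 0)) (by simp), ← dotProduct_add, ← dotProduct_sub]
    congr 1
    funext e
    simp only [Pi.add_apply, Pi.sub_apply, hP, dotProduct_add, dotProduct_zero]
    ring)
  refine ⟨α, tz (v (φ (ι 0))), fun i => ?_⟩
  rw [← hα]
  obtain ⟨c, hc⟩ := hA {φ i, φ (ι (P i))} (Finset.card_le_two.trans (by norm_num)) (fun i => tz (v i))
  try simp only
  rw [hc (φ i) (by simp), hc (φ (ι (P i))) (by simp)]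
  congr 1
  funext e
  rw [hP, hab]

theorem exists_test {D N : ℕ} (P : Fin N → (Fin D → ZMod 2)) (hA : CA 8 P) (hN : D + 1 < N) :
    ∃ (n : ℕ) (f : (Fin (n + 1) → Bool) → Option Bool) (M : Fin N → Fin (n + 1) → Bool)
      (v : Fin N → Bool), (∀ x a, f x = some a → ∃ i, x = M i ∧ a = v i) ∧
      (∀ i, f (M i) = some (v i)) ∧ (∀ c ∈ RR P, ∃ j, ∀ i, M i j = c i) ∧
      (∀ j, (fun i => M i j) ∈ RR P) ∧ v ∉ RR P := by
  classical
  obtain ⟨v, hv⟩ := RR_ne P hN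
  have hne : Nonempty (RR P) := ⟨⟨fun _ => false, 0, 0, fun i => by simp [tz]⟩⟩
  obtain ⟨n, hn⟩ : ∃ n, Fintype.card (RR P) = n + 1 :=
    ⟨Fintype.card (RR P) - 1, by have := Fintype.card_pos (α := RR P); omega⟩
  let E : RR P ≃ Fin (n + 1) := Fintype.equivFinOfCardEq hn
  let M : Fin N → Fin (n + 1) → Bool := fun i j => (E.symm j).1 i
  have hM : ∀ c ∈ RR P, ∃ j, ∀ i, M i j = c i := fun c hc => ⟨E ⟨c, hc⟩, fun i => by simp [M]⟩
  have hinj : ∀ i i', M i = M i' → i = i' := by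
    intro i i' h
    by_contra hne
    obtain ⟨a, ha⟩ := hA {i, i'} (Finset.card_le_two.trans (by norm_num))
      (fun k => if k = i then 1 else 0)
    have h1 := ha i (by simp)
    have h2 := ha i' (by simp)
    obtain ⟨j, hj⟩ := hM (fun k => tb (a ⬝ᵥ P k)) ⟨a, 0, fun i => by rw [tz_tb, add_zero]⟩
    have h3 := congrFun h j
    rw [hj, hj, ← h1, ← h2] at h3
    simp [Ne.symm hne, tb] at h3
  refine ⟨n, fun x => if h : ∃ i, M i = x then some (v h.choose) else none, M, v, ?_, ?_, hM, ?_, hv⟩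
  · intro x a h
    dsimp only at h
    split_ifs at h with h'
    exact ⟨h'.choose, h'.choose_spec.symm, (Option.some.inj h).symm⟩
  · intro i
    have h : ∃ i', M i' = M i := ⟨i, rfl⟩
    try simp only
    rw [dif_pos h, hinj _ _ h.choose_spec]
  · intro j
    exact (E.symm j).2

theorem exists_family : ∃ (N D : ℕ → ℕ) (P : ∀ k, Fin (N k) → (Fin (D k) → ZMod 2)),
    (∀ k, D k + 1 < N k) ∧ (∀ k, CA 8 (P k)) ∧
    (∀ j k, j < k → CA (N j) (P k) ∧ ∃ s, D j ≤ s ∧ CB s (P k)) := by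
  choose N D P h1 hA hB using exists_code
  let t : ℕ → ℕ := fun n => Nat.rec 8 (fun _ t => t + N t + D t) n
  have ht : ∀ n, t (n + 1) = t n + N (t n) + D (t n) := fun n => rfl
  have hmono : Monotone t := monotone_nat_of_le_succ fun n => by rw [ht]; omega
  have hCA : ∀ k r, r ≤ t k → CA r (P (t k)) := fun k r hr T hT => hA (t k) T (hT.trans hr)
  refine ⟨fun k => N (t k), fun k => D (t k), fun k => P (t k), fun k => h1 _,
    fun k => hCA k 8 (hmono (Nat.zero_le k)), fun j k hjk => ?_⟩
  have h := hmono (Nat.succ_le_of_lt hjk)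
  rw [Nat.succ_eq_add_one, ht] at h
  exact ⟨hCA k _ (by show N (t j) ≤ t k; omega), t k, by show D (t j) ≤ t k; omega, hB _⟩

theorem loc_strong (h : ℕ) (D : Set (PF Bool)) : IsStrong (Loc h D) :=
  strong_of fun _ _ _ hg hle x v hx => hg x v fun j => hle _ _ (hx j)

theorem Istr_lower (D : Set (PF Bool)) (hD : IsClone D) (hDL : D ⊆ Lclone) :
    ∃ X : Set ℕ → Set (PF Bool), Function.Injective X ∧ ∀ S, X S ∈ Istr D := by
  classical
  obtain ⟨N, d, P, hN, hA, hlt⟩ := exists_family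
  have htest := fun k => exists_test (P k) (hA k) (hN k)
  choose n f M v hf hfM hcol hM hv using htest
  let T : ℕ → PF Bool := fun k => ⟨n k, f k⟩
  let X : Set ℕ → Set (PF Bool) := fun S => {g | g ∈ Loc 8 D ∧ ∀ k ∈ S, g ∈ pPolSet (RR (P k))}
  have hTloc : ∀ k, T k ∈ Loc 8 D := by
    intro k x w hx
    have h1 := fun j => hf k _ _ (hx j)
    choose i hi hw using h1
    obtain ⟨a, ha⟩ := hA k (Finset.univ.image i) (Finset.card_image_le.trans (by simp))
      (fun i => tz (v k i))
    obtain ⟨c, hc⟩ := hcol k (fun i => tb (a ⬝ᵥ P k i)) ⟨a, 0, fun i => by rw [tz_tb, add_zero]⟩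
    refine ⟨fun x => some (x c), hD.1.1 (n k) c, fun j => ?_⟩
    have e : x j c = w j := by
      rw [hw, ← tb_tz (v k (i j)), ha (i j) (by simp), ← hc]
      exact congrFun (hi j) c
    exact congrArg some e
  have hTnot : ∀ k, T k ∉ pPolSet (RR (P k)) := fun k h =>
    hv k (h (M k) (v k) (hM k) (hfM k))
  have hTpol : ∀ j k, j ≠ k → T k ∈ pPolSet (RR (P j)) := by
    intro j k hjk M' w hM' hw
    have h1 := fun i => hf k _ _ (hw i)
    choose φ hφ hwφ using h1
    have hw' : w = fun i => v k (φ i) := funext hwφ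
    rw [hw']
    have hhom : ∀ c ∈ RR (P k), (fun i => c (φ i)) ∈ RR (P j) := by
      intro c hc
      obtain ⟨l, hl⟩ := hcol k c hc
      have := hM' l
      convert this using 2 with i
      rw [hφ, hl]
    rcases lt_or_gt_of_ne hjk with h | h
    · exact hom_small _ _ (hlt j k h).1 φ hhom _
    · obtain ⟨s, hs, hB⟩ := (hlt k j h).2
      exact hom_big _ _ hB hs (fun T hT => hA k T (hT.trans (by norm_num))) φ hhom _
  have hmem : ∀ S k, T k ∈ X S ↔ k ∉ S := by
    intro S k
    constructor
    · intro h hk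
      exact hTnot k (h.2 k hk)
    · intro hk
      exact ⟨hTloc k, fun j hj => hTpol j k (by rintro rfl; exact hk hj)⟩
  refine ⟨X, ?_, ?_⟩
  · intro S S' h
    ext k
    rw [← not_iff_not, ← hmem S, ← hmem S', h]
  · intro S
    refine ⟨⟨?_, ?_⟩, ?_, ?_⟩
    · intro n i
      exact ⟨(loc_clone hD.1).1 n i, fun k _ => (ppol_clone _).1 n i⟩
    · intro f hf m g hg
      exact ⟨(loc_clone hD.1).2 f hf.1 m g (fun i => (hg i).1),
        fun k hk => (ppol_clone _).2 f (hf.2 k hk) m g (fun i => (hg i).2 k hk)⟩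
    · refine strong_of fun n f g hg hle => ⟨?_, fun k hk => ?_⟩
      · exact fun x v hx => hg.1 x v fun j => hle _ _ (hx j)
      · exact fun M v hM hv => hg.2 k hk M v hM fun i => hle _ _ (hv i)
    · have e := loc_total hD hDL
      apply Set.Subset.antisymm
      · rintro f ⟨hf, ho⟩
        rw [← e]; exact ⟨hf.1, ho⟩
      · intro f hf
        have := hf
        rw [← e] at this
        exact ⟨⟨this.1, fun k _ => L_pres _ (hDL hf)⟩, this.2⟩

theorem Istr_subclone_of_L_continuum (D : Set (PF Bool)) (hD : IsClone D)
    (hDL : D ⊆ Lclone) : Cardinal.mk ↥(Istr D) = Cardinal.continuum := by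
  apply le_antisymm
  · have hc : Countable (PF Bool) :=
      inferInstanceAs (Countable (Σ n : ℕ, (Fin (n+1) → Bool) → Option Bool))
    refine (Cardinal.mk_set_le _).trans ?_
    rw [Cardinal.mk_set, ← Cardinal.two_power_aleph0]
    exact Cardinal.power_le_power_left two_ne_zero (Cardinal.mk_le_aleph0)
  · obtain ⟨X, hX, hXI⟩ := Istr_lower D hD hDL
    have h : Cardinal.mk (Set ℕ) ≤ Cardinal.mk ↥(Istr D) :=
      Cardinal.mk_le_of_injective (f := fun S => (⟨X S, hXI S⟩ : ↥(Istr D)))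
        (fun S S' h => hX (congrArg Subtype.val h))
    rwa [Cardinal.mk_set, Cardinal.mk_nat, Cardinal.two_power_aleph0] at h

end StrongPartial
end

section
/- For every n ≥ 2: Pol R^{0,2}_n = Pol R^{0,2}_{C,n} = Pol R^{0,2}_{K,n} = T_{0,2}. -/
namespace StrongPartial

variable {A : Type}

theorem aux_mem_rel02 (x : Fin 2 → Bool) : x ∈ rel02 ↔ ¬ (x 0 = true ∧ x 1 = true) := by
  have hx : x = ![x 0, x 1] := by
    ext i; fin_cases i <;> rfl
  rw [hx]
  generalize x 0 = a
  generalize x 1 = b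
  cases a <;> cases b <;> simp [rel02]

theorem aux_graph {h : ℕ} (R : Set (Fin h → Bool)) (E : Fin h → Fin h → Prop)
    (hR : ∀ x, x ∈ R ↔ ∀ i j, E i j → ¬ (x i = true ∧ x j = true))
    (hirr : ∀ i j, E i j → i ≠ j) (a b : Fin h) (hab : E a b) : PolSet R = T02 := by
  have hne := hirr a b hab
  ext f
  constructor
  · rintro ⟨hf, ht⟩
    refine ⟨?_, ht⟩
    intro M v hM hv
    have hf' : Preserves f R := hf
    let M' : Fin h → Fin (f.1+1) → Bool :=
      fun i => if i = a then M 0 else if i = b then M 1 else fun _ => false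
    have key := hf' M' (fun i => (f.2 (M' i)).get (ht (M' i))) ?_ (fun i => by simp)
    · rw [hR] at key
      have k := key a b hab
      have ha : M' a = M 0 := by simp [M']
      have hb : M' b = M 1 := by simp [M', hne.symm]
      rw [aux_mem_rel02]
      simpa [ha, hb, hv 0, hv 1] using k
    · intro j
      rw [hR]
      intro p q hpq
      have hne' := hirr p q hpq
      have hj := hM j
      rw [aux_mem_rel02] at hj
      simp only [M']
      split_ifs <;> first | (simp_all; done) | (rintro ⟨h1, h2⟩; exact hj ⟨h2, h1⟩)
  · rintro ⟨hf, ht⟩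
    refine ⟨?_, ht⟩
    intro M v hM hv
    have hf' : Preserves f rel02 := hf
    rw [hR]
    intro p q hpq
    have key := hf' ![M p, M q] ![v p, v q] ?_ ?_
    · rw [aux_mem_rel02] at key
      simpa using key
    · intro j
      rw [aux_mem_rel02]
      have hj := (hR _).1 (hM j) p q hpq
      simpa using hj
    · intro i
      fin_cases i
      · exact hv p
      · exact hv q

theorem aux_cyc {n : ℕ} (hn : 2 ≤ n) (i : Fin n) : i ≠ cyc i := by
  intro h
  have h1 := congrArg Fin.val h
  simp only [cyc] at h1
  have := i.isLt
  rcases Nat.lt_or_ge (i.val + 1) n with h2 | h2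
  · rw [Nat.mod_eq_of_lt h2] at h1; omega
  · have h3 : i.val + 1 = n := by omega
    rw [h3, Nat.mod_self] at h1; omega

theorem aux_RC {n : ℕ} (x : Fin n → Bool) :
    x ∈ RC n ↔ ∀ i, ¬ (x i = true ∧ x (cyc i) = true) := by
  simp only [RC, Set.mem_setOf_eq, aux_mem_rel02]; rfl

theorem aux_RK {n : ℕ} (x : Fin n → Bool) :
    x ∈ RK n ↔ ∀ i j, i ≠ j → ¬ (x i = true ∧ x j = true) := by
  simp only [RK, Set.mem_setOf_eq, aux_mem_rel02]; rfl

theorem Pol_R02_eq_T02 (n : ℕ) (hn : 2 ≤ n) :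
    PolSet (R02 n) = T02 ∧ PolSet (RC n) = T02 ∧ PolSet (RK n) = T02 := by
  let z : Fin n := ⟨0, by omega⟩
  refine ⟨?_, ?_, ?_⟩
  · refine aux_graph _ (fun p q => (∃ i : Fin n, p = Fin.castAdd n i ∧ q = Fin.castAdd n (cyc i)) ∨
      (∃ i j : Fin n, i ≠ j ∧ p = Fin.natAdd n i ∧ q = Fin.natAdd n j)) ?_ ?_
      (Fin.castAdd n z) (Fin.castAdd n (cyc z)) (Or.inl ⟨z, rfl, rfl⟩)
    · intro x
      simp only [R02, Set.mem_setOf_eq, aux_RC, aux_RK]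
      constructor
      · rintro ⟨h1, h2⟩ p q (⟨i, rfl, rfl⟩ | ⟨i, j, hij, rfl, rfl⟩)
        · exact h1 i
        · exact h2 i j hij
      · intro h
        exact ⟨fun i => h _ _ (Or.inl ⟨i, rfl, rfl⟩),
          fun i j hij => h _ _ (Or.inr ⟨i, j, hij, rfl, rfl⟩)⟩
    · rintro p q (⟨i, rfl, rfl⟩ | ⟨i, j, hij, rfl, rfl⟩) h
      · exact aux_cyc hn i (Fin.castAdd_injective n n h)
      · exact hij (Fin.natAdd_injective n n h)
  · refine aux_graph _ (fun p q => q = cyc p) ?_ ?_ z (cyc z) rfl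
    · intro x
      rw [aux_RC]
      constructor
      · rintro h p q rfl
        exact h p
      · exact fun h i => h i _ rfl
    · rintro p q rfl
      exact aux_cyc hn p
  · exact aux_graph _ (fun p q => p ≠ q) aux_RK (fun _ _ h => h) z (cyc z) (aux_cyc hn z)

end StrongPartial
end

section
/- Let N̂ := {n ∈ ℕ : n odd, n ≥ 3}, n ∈ N̂, and M ⊆ N̂ \ {n}. Then pPol R^{0,2}_n does not contain the intersection ⋂_{m ∈ M} pPol R^{0,2}_m (where the empty intersection is the set of all partial functions on 𝟚); i.e. there exists a partial function preserving R^{0,2}_m for every m ∈ M but not preserving R^{0,2}_n. -/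
namespace StrongPartial

variable {A : Type}

theorem mem_rel02_iff (a b : Bool) : ![a, b] ∈ rel02 ↔ ¬ (a = true ∧ b = true) := by
  unfold rel02
  cases a <;> cases b <;> simp [funext_iff, Fin.forall_fin_two]

def gadj (n : ℕ) : Fin n ⊕ Fin n → Fin n ⊕ Fin n → Prop
  | Sum.inl i, Sum.inl j => j = cyc i ∨ i = cyc j
  | Sum.inr i, Sum.inr j => i ≠ j
  | _, _ => False

theorem cyc_ne {n : ℕ} (hn : 2 ≤ n) (i : Fin n) : cyc i ≠ i := by
  intro h
  have h1 := congrArg Fin.val h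
  have h2 := i.isLt
  simp only [cyc] at h1
  rcases Nat.lt_or_ge (i.val + 1) n with h3 | h3
  · rw [Nat.mod_eq_of_lt h3] at h1; omega
  · have : i.val + 1 = n := by omega
    rw [this, Nat.mod_self] at h1; omega

theorem gadj_symm {n : ℕ} {u v : Fin n ⊕ Fin n} (h : gadj n u v) : gadj n v u := by
  rcases u with i | i <;> rcases v with j | j <;> simp only [gadj] at h ⊢
  · exact h.symm
  · exact h.symm

theorem gadj_irrefl {n : ℕ} (hn : 2 ≤ n) (u : Fin n ⊕ Fin n) : ¬ gadj n u u := by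
  rcases u with i | i <;> simp only [gadj]
  · intro h
    rcases h with h | h <;> exact cyc_ne hn i h.symm
  · simp

theorem gadj_left {n : ℕ} {u v : Fin n ⊕ Fin n} (h : gadj n u v) : u.isLeft = v.isLeft := by
  rcases u with i | i <;> rcases v with j | j <;> simp_all [gadj]

def gpos {n : ℕ} : Fin n ⊕ Fin n → Fin n := Sum.elim id id

theorem cyc_dvd {n : ℕ} (i : Fin n) : (n : ℤ) ∣ ((cyc i).val : ℤ) - (i.val + 1) := by
  simp only [cyc]
  push_cast
  exact (Int.mod_modEq _ _).symm.dvd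

theorem step_dvd {n : ℕ} {u v : Fin n ⊕ Fin n} (h : gadj n u v) (hu : u.isLeft = true) :
    ∃ e : ℤ, (e = 1 ∨ e = -1) ∧ (n : ℤ) ∣ ((gpos v).val : ℤ) - (gpos u).val - e := by
  rcases u with i | i <;> rcases v with j | j <;> simp only [gadj] at h
  rotate_left
  · simp at hu
  rcases h with rfl | rfl
  · refine ⟨1, Or.inl rfl, ?_⟩
    have := cyc_dvd i
    simp only [gpos, Sum.elim_inl, id]
    rwa [← sub_sub] at this
  · refine ⟨-1, Or.inr rfl, ?_⟩
    obtain ⟨a, ha⟩ := cyc_dvd j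
    simp only [gpos, Sum.elim_inl, id]
    exact ⟨-a, by linarith⟩

theorem walk_aux {n : ℕ} (w : ℕ → Fin n ⊕ Fin n) (hw : ∀ k, gadj n (w k) (w (k+1)))
    (h0 : (w 0).isLeft = true) (k : ℕ) :
    (w k).isLeft = true ∧ ∃ z : ℤ, |z| ≤ k ∧ (2 : ℤ) ∣ z - k ∧
      (n : ℤ) ∣ ((gpos (w k)).val : ℤ) - (gpos (w 0)).val - z := by
  induction k with
  | zero => exact ⟨h0, 0, by simp⟩
  | succ k ih =>
    obtain ⟨hl, z, hz1, hz2, hz3⟩ := ih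
    obtain ⟨e, he, hd⟩ := step_dvd (hw k) hl
    refine ⟨(gadj_left (hw k)) ▸ hl, z + e, ?_, ?_, ?_⟩
    · rw [abs_le] at *
      push_cast
      rcases he with rfl | rfl <;> constructor <;> linarith
    · push_cast
      rcases he with rfl | rfl <;> omega
    · obtain ⟨a, ha⟩ := hz3
      obtain ⟨b, hb⟩ := hd
      exact ⟨a + b, by linarith⟩

theorem no_walk {n m : ℕ} (hm : Odd m) (hmn : m < n) (u : Fin m → Fin n ⊕ Fin n)
    (hu : ∀ i, gadj n (u i) (u (cyc i))) (s : Fin m) : (u s).isLeft = false := by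
  by_contra hs
  have hs : (u s).isLeft = true := by simpa using hs
  have hpos : 0 < m := s.pos
  let w : ℕ → Fin n ⊕ Fin n := fun k => u ⟨(s.val + k) % m, Nat.mod_lt _ hpos⟩
  have hw0 : w 0 = u s := by
    simp only [w]; congr 1; ext; simp [Nat.mod_eq_of_lt s.isLt]
  have hwm : w m = u s := by
    simp only [w]; congr 1; ext; simp [Nat.mod_eq_of_lt s.isLt]
  have hw : ∀ k, gadj n (w k) (w (k+1)) := by
    intro k
    have := hu ⟨(s.val + k) % m, Nat.mod_lt _ hpos⟩
    convert this using 1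
    simp only [w, cyc]; congr 1; ext; simp [← add_assoc]
  obtain ⟨_, z, hz1, hz2, hz3⟩ := walk_aux w hw (by rw [hw0]; exact hs) m
  rw [hw0, hwm] at hz3
  simp only [sub_self, zero_sub, dvd_neg] at hz3
  have : z = 0 := Int.eq_zero_of_abs_lt_dvd hz3 (by omega)
  subst this
  obtain ⟨r, rfl⟩ := hm
  push_cast at hz2
  omega

theorem R02_nonconstructible (n : ℕ) (hn : 3 ≤ n) (hodd : Odd n)
    (M : Set ℕ) (hM : ∀ m ∈ M, Odd m ∧ 3 ≤ m ∧ m ≠ n) :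
    ¬ ({f : PF Bool | ∀ m ∈ M, Preserves f (R02 m)} ⊆ pPolSet (R02 n)) := by
  classical
  have hn2 : 2 ≤ n := by omega
  let V := Fin n ⊕ Fin n
  obtain ⟨k, hk⟩ : ∃ k, Fintype.card (V × V) = k + 1 := by
    have : Nonempty V := ⟨Sum.inl ⟨0, by omega⟩⟩
    exact ⟨_, (Nat.succ_pred_eq_of_pos Fintype.card_pos).symm⟩
  let e : V × V ≃ Fin (k+1) := Fintype.equivFinOfCardEq hk
  let row : V → Fin (k+1) → Bool := fun w c =>
    decide (¬ gadj n (e.symm c).1 (e.symm c).2 ∧ (w = (e.symm c).1 ∨ w = (e.symm c).2))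
  have hrow : ∀ u v, gadj n u v ↔ ∀ c, ¬ (row u c = true ∧ row v c = true) := by
    intro u v
    constructor
    · intro h c
      simp only [row, decide_eq_true_eq]
      generalize e.symm c = p
      rintro ⟨⟨h1, h2⟩, _, h3⟩
      rcases h2 with rfl | rfl <;> rcases h3 with rfl | rfl
      · exact gadj_irrefl hn2 _ h
      · exact h1 h
      · exact h1 (gadj_symm h)
      · exact gadj_irrefl hn2 _ h
    · intro h
      by_contra hc
      apply h (e (u, v))
      simp [row, hc]
  have hinj : Function.Injective row := by
    intro u v h
    have := congrFun h (e (u, u))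
    simp [row, gadj_irrefl hn2] at this
    exact this.symm
  let g : (Fin (k+1) → Bool) → Option Bool := fun x =>
    if h : ∃ w, row w = x then some h.choose.isLeft else none
  have hg1 : ∀ w, g (row w) = some w.isLeft := by
    intro w
    have h : ∃ w', row w' = row w := ⟨w, rfl⟩
    simp only [g, dif_pos h]
    rw [hinj h.choose_spec]
  have hg2 : ∀ x b, g x = some b → ∃ w, row w = x ∧ w.isLeft = b := by
    intro x b hx
    by_cases h : ∃ w, row w = x
    · obtain ⟨w, rfl⟩ := h
      rw [hg1] at hx
      exact ⟨w, rfl, by simpa using hx⟩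
    · simp [g, dif_neg h] at hx
  intro hsub
  have hf : (⟨k, g⟩ : PF Bool) ∈ pPolSet (R02 n) := by
    apply hsub
    intro m hm X v hX hv
    obtain ⟨hmo, hm3, hmn⟩ := hM m hm
    choose w hw1 hw2 using fun i => hg2 _ _ (hv i)
    have hC : ∀ i : Fin m, gadj n (w (Fin.castAdd m i)) (w (Fin.castAdd m (cyc i))) := by
      intro i
      rw [hrow]
      intro c
      have := (hX c).1 i
      rw [mem_rel02_iff] at this
      rw [hw1, hw1]
      exact this
    have hK : ∀ i j : Fin m, i ≠ j → gadj n (w (Fin.natAdd m i)) (w (Fin.natAdd m j)) := by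
      intro i j hij
      rw [hrow]
      intro c
      have := (hX c).2 i j hij
      rw [mem_rel02_iff] at this
      rw [hw1, hw1]
      exact this
    rcases Nat.lt_or_gt_of_ne hmn with hlt | hgt
    · have h1 := no_walk hmo hlt (fun i => w (Fin.castAdd m i)) hC
      have h2 := no_walk hmo hlt (fun i => w (Fin.natAdd m i))
        (fun i => hK _ _ (cyc_ne (by omega) i).symm)
      refine ⟨fun i => ?_, fun i j _ => ?_⟩
      · rw [mem_rel02_iff]
        rintro ⟨h3, -⟩
        have h4 := (hw2 (Fin.castAdd m i)).symm.trans (h1 i)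
        exact absurd (h3.symm.trans h4) (by decide)
      · rw [mem_rel02_iff]
        rintro ⟨h3, -⟩
        have h4 := (hw2 (Fin.natAdd m i)).symm.trans (h2 i)
        exact absurd (h3.symm.trans h4) (by decide)
    · exfalso
      have hi : Function.Injective (fun i : Fin m => gpos (w (Fin.natAdd m i))) := by
        intro i j hij
        change gpos (w (Fin.natAdd m i)) = gpos (w (Fin.natAdd m j)) at hij
        by_contra hne
        have h := hK i j hne
        have hl := gadj_left h
        have : w (Fin.natAdd m i) = w (Fin.natAdd m j) := by
          revert hij hl
          generalize w (Fin.natAdd m i) = a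
          generalize w (Fin.natAdd m j) = b
          rcases a with a | a <;> rcases b with b | b <;> simp [gpos] <;> rintro rfl <;> rfl
        rw [this] at h
        exact gadj_irrefl hn2 _ h
      have := Fintype.card_le_of_injective _ hi
      simp at this
      omega
  have := hf (fun i => row (finSumFinEquiv.symm i)) (fun i => (finSumFinEquiv.symm i).isLeft)
    (by
      intro c
      refine ⟨fun i => ?_, fun i j hij => ?_⟩
      · rw [mem_rel02_iff]
        simp only [finSumFinEquiv_symm_apply_castAdd]
        exact (hrow _ _).1 (by simp [gadj]) c
      · rw [mem_rel02_iff]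
        simp only [finSumFinEquiv_symm_apply_natAdd]
        exact (hrow _ _).1 (by simpa [gadj] using hij) c)
    (fun i => hg1 _)
  have h0 := this.1 ⟨0, by omega⟩
  rw [mem_rel02_iff] at h0
  apply h0
  simp only [finSumFinEquiv_symm_apply_castAdd]
  simp

end StrongPartial
end
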